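/- arXiv:1103.4097 — 3 statements merged into one kernel-verified Lean document; each statement's English description precedes it below -/
import Mathlib

section
/- For every natural number k, the two-sided translation representation on V_k is irreducible as a quaternionic representation: if W is a real subspace of V_k such that (a) for every σ ∈ W and every q ∈ ℍ the pointwise right product σ·q lies in W, and (b) for all unit quaternions s, t (|s| = |t| = 1) and every σ ∈ W the function x ↦ σ(t⁻¹·x·s) lies in W, then W = {0} or W = V_k. -/
open Quaternion MvPolynomial

noncomputable section

/-- The standard imaginary quaternion units. -/
def e1 : ℍ[ℝ] := ⟨0, 1, 0, 0⟩
def e2 : ℍ[ℝ] := ⟨0, 0, 1, 0⟩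
def e3 : ℍ[ℝ] := ⟨0, 0, 0, 1⟩

/-- Infinitesimal right translation: `(L_v σ)(x) = Dσ(x)[x·v]`. -/
def Lop (v : ℍ[ℝ]) (σ : ℍ[ℝ] → ℍ[ℝ]) : ℍ[ℝ] → ℍ[ℝ] :=
  fun x => fderiv ℝ σ x (x * v)

/-- The operator `D̄σ = −((L₁σ)·e₁ + (L₂σ)·e₂ + (L₃σ)·e₃)`. -/
def Dbar (σ : ℍ[ℝ] → ℍ[ℝ]) : ℍ[ℝ] → ℍ[ℝ] :=
  fun x => -(Lop e1 σ x * e1 + Lop e2 σ x * e2 + Lop e3 σ x * e3)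

/-- The four real coordinates of a quaternion. -/
def coords (x : ℍ[ℝ]) : Fin 4 → ℝ := ![x.re, x.imI, x.imJ, x.imK]

/-- `σ ∈ V_k`: each of the four real components of `σ` is (given by) a harmonic
polynomial on `ℝ⁴`, homogeneous of degree `k`. -/
def memVk (k : ℕ) (σ : ℍ[ℝ] → ℍ[ℝ]) : Prop :=
  ∀ c : Fin 4, ∃ P : MvPolynomial (Fin 4) ℝ,
    P.IsHomogeneous k ∧ (∑ i : Fin 4, pderiv i (pderiv i P)) = 0 ∧
    ∀ x : ℍ[ℝ], eval (coords x) P = coords (σ x) c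

/-- `V_k` as a set. -/
def VkSet (k : ℕ) : Set (ℍ[ℝ] → ℍ[ℝ]) := {σ | memVk k σ}

lemma hasDerivAt_evalP (P : MvPolynomial (Fin 4) ℝ) (γ : ℝ → Fin 4 → ℝ) (γ' : Fin 4 → ℝ) (θ : ℝ)
    (h : ∀ i, HasDerivAt (fun s => γ s i) (γ' i) θ) :
    HasDerivAt (fun s => eval (γ s) P) (∑ i, eval (γ θ) (pderiv i P) * γ' i) θ := by
  induction P using MvPolynomial.induction_on with
  | C a => simpa using hasDerivAt_const θ a
  | add p q hp hq =>
    simp only [map_add, add_mul, Finset.sum_add_distrib]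
    exact hp.add hq
  | mul_X p j hp =>
    have := hp.mul (h j)
    have e : (fun s => eval (γ s) (p * X j)) = (fun s => eval (γ s) p) * fun s => γ s j := by
      ext s; simp
    rw [e]
    refine this.congr_deriv ?_
    simp only [Derivation.leibniz, pderiv_X, smul_eq_mul, map_add, map_mul, eval_X, add_mul,
      Finset.sum_add_distrib, Finset.sum_mul]
    rw [add_comm]
    congr 1
    · rw [Finset.sum_eq_single j]
      · simp
      · intro b _ hb
        simp [Pi.single_apply, hb.symm]
      · simp
    · exact Finset.sum_congr rfl fun i _ => by ring

/-- substitution by a matrix -/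
def subM (M : Matrix (Fin 4) (Fin 4) ℝ) : MvPolynomial (Fin 4) ℝ →ₐ[ℝ] MvPolynomial (Fin 4) ℝ :=
  aeval (fun j => ∑ i, C (M j i) * X i)

lemma pderiv_subM (M : Matrix (Fin 4) (Fin 4) ℝ) (P : MvPolynomial (Fin 4) ℝ) (i : Fin 4) :
    pderiv i (subM M P) = ∑ j, subM M (pderiv j P) * C (M j i) := by
  induction P using MvPolynomial.induction_on with
  | C a => simp [subM]
  | add p q hp hq =>
    simp only [map_add, add_mul, Finset.sum_add_distrib, hp, hq]
  | mul_X p j hp =>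
    have hX : pderiv i (subM M (X j)) = C (M j i) := by
      simp [subM, Derivation.leibniz, pderiv_X, Pi.single_apply]
    simp only [map_mul, Derivation.leibniz, smul_eq_mul, map_add, hp, hX, add_mul,
      Finset.sum_add_distrib, Finset.mul_sum]
    refine congrArg₂ (· + ·) ?_ ?_
    · rw [Finset.sum_eq_single j]
      · simp
      · intro b _ hb
        simp [pderiv_X, Pi.single_apply, hb.symm]
      · simp
    · exact Finset.sum_congr rfl fun i _ => by ring

lemma laplace_subM (M : Matrix (Fin 4) (Fin 4) ℝ) (hM : M * M.transpose = 1)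
    (P : MvPolynomial (Fin 4) ℝ) :
    (∑ i, pderiv i (pderiv i (subM M P))) = subM M (∑ i, pderiv i (pderiv i P)) := by
  have h1 : ∀ i, pderiv i (pderiv i (subM M P)) =
      ∑ j, ∑ l, subM M (pderiv l (pderiv j P)) * C (M j i * M l i) := by
    intro i
    rw [pderiv_subM, map_sum]
    refine Finset.sum_congr rfl fun j _ => ?_
    simp only [Derivation.leibniz, pderiv_C, mul_zero, zero_add, pderiv_subM, smul_eq_mul,
      Finset.mul_sum, C_mul]
    exact Finset.sum_congr rfl fun l _ => by ring
  simp only [h1]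
  rw [Finset.sum_comm, map_sum]
  refine Finset.sum_congr rfl fun j _ => ?_
  rw [Finset.sum_comm]
  have h2 : ∀ l, ∑ i, subM M (pderiv l (pderiv j P)) * C (M j i * M l i) =
      subM M (pderiv l (pderiv j P)) * C ((1 : Matrix (Fin 4) (Fin 4) ℝ) j l) := by
    intro l
    rw [← Finset.mul_sum, ← map_sum, ← hM]
    rfl
  simp_rw [h2]
  simp [Matrix.one_apply]

lemma hom_subM (M : Matrix (Fin 4) (Fin 4) ℝ) {P : MvPolynomial (Fin 4) ℝ} {k : ℕ}
    (h : P.IsHomogeneous k) : (subM M P).IsHomogeneous k := by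
  have := h.aeval (S := ℝ) (fun j => ∑ i, C (M j i) * X i) (n := 1) (fun j => by
    refine IsHomogeneous.sum _ _ _ fun i _ => ?_
    exact (isHomogeneous_X ℝ i).C_mul (M j i))
  simpa [subM] using this

lemma eval_subM (M : Matrix (Fin 4) (Fin 4) ℝ) (P : MvPolynomial (Fin 4) ℝ) (v : Fin 4 → ℝ) :
    eval v (subM M P) = eval (M.mulVec v) P := by
  induction P using MvPolynomial.induction_on with
  | C a => simp [subM]
  | add p q hp hq => simp [hp, hq]
  | mul_X p j hp =>
    rw [map_mul, map_mul, hp, map_mul]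
    simp [subM, Matrix.mulVec, dotProduct]

lemma eval_smulP {P : MvPolynomial (Fin 4) ℝ} {k : ℕ} (h : P.IsHomogeneous k) (r : ℝ)
    (v : Fin 4 → ℝ) : eval (fun i => r * v i) P = r ^ k * eval v P := by
  rw [eval_eq', eval_eq', Finset.mul_sum]
  refine Finset.sum_congr rfl fun d hd => ?_
  have : ∑ i, d i = k := by
    have := h.degree_eq_sum_deg_support hd
    rw [this, ← Finsupp.degree_apply, Finsupp.degree_eq_sum]
  simp only [mul_pow, Finset.prod_mul_distrib, Finset.prod_pow_eq_pow_sum, this]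
  ring

lemma normSq_of_norm_one {s : ℍ[ℝ]} (hs : ‖s‖ = 1) :
    s.re ^ 2 + s.imI ^ 2 + s.imJ ^ 2 + s.imK ^ 2 = 1 := by
  have := Quaternion.normSq_eq_norm_mul_self s
  rw [hs, Quaternion.normSq_def'] at this
  linarith

lemma inv_of_norm_one {s : ℍ[ℝ]} (hs : ‖s‖ = 1) : s⁻¹ = star s := by
  have := Quaternion.normSq_eq_norm_mul_self s
  apply inv_eq_of_mul_eq_one_right
  rw [Quaternion.self_mul_star, this, hs]
  simp

def Lmat (s : ℍ[ℝ]) : Matrix (Fin 4) (Fin 4) ℝ :=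
  !![s.re, -s.imI, -s.imJ, -s.imK; s.imI, s.re, -s.imK, s.imJ;
    s.imJ, s.imK, s.re, -s.imI; s.imK, -s.imJ, s.imI, s.re]
def Rmat (s : ℍ[ℝ]) : Matrix (Fin 4) (Fin 4) ℝ :=
  !![s.re, -s.imI, -s.imJ, -s.imK; s.imI, s.re, s.imK, -s.imJ;
    s.imJ, -s.imK, s.re, s.imI; s.imK, s.imJ, -s.imI, s.re]

lemma Lmat_mulVec (s x : ℍ[ℝ]) : (Lmat s).mulVec (coords x) = coords (s * x) := by
  ext i; fin_cases i <;> simp [Lmat, coords, Matrix.mulVec, dotProduct, Fin.sum_univ_four] <;> ring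
lemma Rmat_mulVec (s x : ℍ[ℝ]) : (Rmat s).mulVec (coords x) = coords (x * s) := by
  ext i; fin_cases i <;> simp [Rmat, coords, Matrix.mulVec, dotProduct, Fin.sum_univ_four] <;> ring
lemma Lmat_orth {s : ℍ[ℝ]} (hs : ‖s‖ = 1) : Lmat s * (Lmat s).transpose = 1 := by
  have := normSq_of_norm_one hs
  ext i j; fin_cases i <;> fin_cases j <;>
    simp [Lmat, Matrix.mul_apply, Fin.sum_univ_four, Matrix.one_apply] <;>
    first | linear_combination this | ring
lemma Rmat_orth {s : ℍ[ℝ]} (hs : ‖s‖ = 1) : Rmat s * (Rmat s).transpose = 1 := by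
  have := normSq_of_norm_one hs
  ext i j; fin_cases i <;> fin_cases j <;>
    simp [Rmat, Matrix.mul_apply, Fin.sum_univ_four, Matrix.one_apply] <;>
    first | linear_combination this | ring

lemma memVk_trans {k : ℕ} {σ : ℍ[ℝ] → ℍ[ℝ]} (h : memVk k σ) {s t : ℍ[ℝ]} (hs : ‖s‖ = 1)
    (ht : ‖t‖ = 1) : memVk k (fun x => σ (t⁻¹ * x * s)) := by
  intro c
  obtain ⟨P, h1, h2, h3⟩ := h c
  have ht' : ‖t⁻¹‖ = 1 := by simp [ht]
  refine ⟨subM (Lmat t⁻¹) (subM (Rmat s) P), hom_subM _ (hom_subM _ h1), ?_, fun x => ?_⟩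
  · rw [laplace_subM _ (Lmat_orth ht'), laplace_subM _ (Rmat_orth hs), h2, map_zero, map_zero]
  · rw [eval_subM, Lmat_mulVec, eval_subM, Rmat_mulVec, h3]

lemma coords_surj (v : Fin 4 → ℝ) : ∃ x : ℍ[ℝ], coords x = v :=
  ⟨⟨v 0, v 1, v 2, v 3⟩, by ext i; fin_cases i <;> rfl⟩

lemma poly_zero_of {P : MvPolynomial (Fin 4) ℝ} (h : ∀ x : ℍ[ℝ], eval (coords x) P = 0) : P = 0 := by
  apply MvPolynomial.funext
  intro v
  obtain ⟨x, rfl⟩ := coords_surj v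
  simp [h]

lemma coords_smul (r : ℝ) (x : ℍ[ℝ]) : coords (r • x) = fun i => r * coords x i := by
  ext i; fin_cases i <;> simp [coords]

def mkH (a b c d : ℝ) : ℍ[ℝ] := ⟨a, b, c, d⟩
@[simp] lemma mkH_re (a b c d : ℝ) : (mkH a b c d).re = a := rfl
@[simp] lemma mkH_imI (a b c d : ℝ) : (mkH a b c d).imI = b := rfl
@[simp] lemma mkH_imJ (a b c d : ℝ) : (mkH a b c d).imJ = c := rfl
@[simp] lemma mkH_imK (a b c d : ℝ) : (mkH a b c d).imK = d := rfl

lemma deriv_trig_add (a b : ℝ) :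
    HasDerivAt (fun s => a * Real.cos s + b * Real.sin s) b 0 :=
  (((Real.hasDerivAt_cos 0).const_mul a).fun_add ((Real.hasDerivAt_sin 0).const_mul b)).congr_deriv
    (by simp)

lemma deriv_trig_sub (a b : ℝ) :
    HasDerivAt (fun s => a * Real.cos s - b * Real.sin s) (-b) 0 :=
  (((Real.hasDerivAt_cos 0).const_mul a).fun_sub ((Real.hasDerivAt_sin 0).const_mul b)).congr_deriv
    (by simp)

/-- restriction to the line `(1, b, 0, 0)` -/
def lineP : MvPolynomial (Fin 4) ℝ →ₐ[ℝ] Polynomial ℝ :=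
  aeval ![1, Polynomial.X, 0, 0]

lemma derivative_lineP (P : MvPolynomial (Fin 4) ℝ) :
    Polynomial.derivative (lineP P) = lineP (pderiv 1 P) := by
  induction P using MvPolynomial.induction_on with
  | C a => simp [lineP]
  | add p q hp hq => simp [hp, hq]
  | mul_X p j hp =>
    rw [map_mul, Polynomial.derivative_mul, hp, Derivation.leibniz, map_add, smul_eq_mul,
      smul_eq_mul, map_mul, map_mul]
    fin_cases j <;> simp [lineP, pderiv_X, Pi.single_apply] <;> ring

lemma eval_lineP (P : MvPolynomial (Fin 4) ℝ) (b : ℝ) :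
    Polynomial.eval b (lineP P) = eval (coords (mkH 1 b 0 0)) P := by
  induction P using MvPolynomial.induction_on with
  | C a => simp [lineP]
  | add p q hp hq => simp [hp, hq]
  | mul_X p j hp =>
    rw [map_mul, Polynomial.eval_mul, hp, map_mul]
    fin_cases j <;> simp [lineP, coords]

lemma lineP_zero {k : ℕ} {f : MvPolynomial (Fin 4) ℝ} (hf : f.IsHomogeneous k)
    (hΔ : (∑ i : Fin 4, pderiv i (pderiv i f)) = 0)
    (h12 : X 1 * pderiv 2 f = X 2 * pderiv 1 f) (h13 : X 1 * pderiv 3 f = X 3 * pderiv 1 f)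
    (h1 : eval (coords 1) f = 0) : lineP f = 0 := by
  have d2 := congrArg (pderiv 2) h12
  have d3 := congrArg (pderiv 3) h13
  have l2 := congrArg lineP d2
  have l3 := congrArg lineP d3
  have lΔ := congrArg lineP hΔ
  have E1 := congrArg lineP hf.sum_X_mul_pderiv
  have E2 := congrArg lineP (hf.pderiv (i := 0)).sum_X_mul_pderiv
  have L0 : lineP (X 0) = 1 := by simp [lineP]
  have L1 : lineP (X 1) = Polynomial.X := by simp [lineP]
  have L2 : lineP (X 2) = 0 := by simp [lineP]
  have L3 : lineP (X 3) = 0 := by simp [lineP]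
  simp only [Derivation.leibniz, smul_eq_mul, map_add, map_mul, L1, L2, L3, pderiv_X_self,
    zero_mul, map_one, mul_one, zero_add] at l2 l3
  rw [pderiv_X_of_ne (by decide)] at l2 l3
  simp only [map_zero, mul_zero, add_zero] at l2 l3
  simp only [Fin.sum_univ_four, map_add, map_mul, L0, L1, L2, L3, map_nsmul, map_zero, zero_mul,
    add_zero, one_mul, ← derivative_lineP] at lΔ E1 E2 l2 l3
  set p := lineP f with hp
  set a := lineP (pderiv 0 f) with ha
  have ha' : a = k • p - Polynomial.X * Polynomial.derivative p := by rw [← E1]; ring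
  have hODE : Polynomial.X * ((k - 1) • a - Polynomial.X * Polynomial.derivative a) +
      Polynomial.X * Polynomial.derivative (Polynomial.derivative p) +
      2 * Polynomial.derivative p = 0 := by
    rw [← E2]
    linear_combination Polynomial.X * lΔ - l2 - l3
  have hc : ∀ m, ∃ r : ℝ, r * p.coeff m + (m + 2) * (m + 3) * p.coeff (m + 2) = 0 := by
    intro m
    have := congrArg (fun q => Polynomial.coeff q (m + 1)) hODE
    have ca : a.coeff m = (k - m) * p.coeff m := by
      rw [ha']
      cases m <;> simp [Polynomial.coeff_derivative]
      ring
    have cXa : (Polynomial.X * Polynomial.derivative a).coeff m = m * a.coeff m := by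
      cases m <;> simp [Polynomial.coeff_derivative]
      ring
    have c2 : ((2 : Polynomial ℝ) * Polynomial.derivative p).coeff (m+1)
        = 2 * (p.coeff (m+2) * (m + 2)) := by
      rw [two_mul, Polynomial.coeff_add, Polynomial.coeff_derivative]
      push_cast
      ring
    have c3 : ((k - 1) • a).coeff m = ((k - 1 : ℕ) : ℝ) * a.coeff m := by
      rw [Polynomial.coeff_smul, nsmul_eq_mul]
    simp only [Polynomial.coeff_add, Polynomial.coeff_X_mul, Polynomial.coeff_sub,
      c3, cXa, c2, ca, Polynomial.coeff_derivative, Polynomial.coeff_zero] at this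
    refine ⟨((k - 1 : ℕ) : ℝ) * (k - m) - m * (k - m), ?_⟩
    push_cast at this
    linear_combination this
  have c0 : p.coeff 0 = 0 := by
    rw [Polynomial.coeff_zero_eq_eval_zero, hp, eval_lineP]
    have : mkH 1 0 0 0 = 1 := by apply Quaternion.ext <;> simp
    rw [this, h1]
  have c1 : p.coeff 1 = 0 := by
    have := congrArg (fun q => Polynomial.coeff q 0) hODE
    rw [two_mul] at this
    simp [Polynomial.coeff_derivative] at this
    linarith
  have hall : ∀ m, p.coeff m = 0 ∧ p.coeff (m + 1) = 0 := by
    intro m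
    induction m with
    | zero => exact ⟨c0, c1⟩
    | succ m ih =>
      refine ⟨ih.2, ?_⟩
      obtain ⟨r, hr⟩ := hc m
      rw [ih.1, mul_zero, zero_add] at hr
      have : ((m : ℝ) + 2) * (m + 3) ≠ 0 := by positivity
      exact (mul_eq_zero.mp hr).resolve_left this
  ext m
  simp [(hall m).1]

lemma inf_inv {f : MvPolynomial (Fin 4) ℝ}
    (hinv : ∀ t : ℍ[ℝ], ‖t‖ = 1 → ∀ x, eval (coords (t⁻¹ * x * t)) f = eval (coords x) f) :
    X 1 * pderiv 2 f = X 2 * pderiv 1 f ∧ X 1 * pderiv 3 f = X 3 * pderiv 1 f := by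
  constructor
  · rw [← sub_eq_zero]
    apply poly_zero_of
    intro x
    let γ : ℝ → Fin 4 → ℝ := fun s => ![x.re, x.imI * Real.cos s + x.imJ * Real.sin s,
      x.imJ * Real.cos s - x.imI * Real.sin s, x.imK]
    have hγ : ∀ s, eval (γ s) f = eval (coords x) f := by
      intro s
      have hn : ‖(mkH (Real.cos (s/2)) 0 0 (Real.sin (s/2)))‖ = 1 := by
        rw [← sq_eq_sq₀ (norm_nonneg _) zero_le_one, sq, ← Quaternion.normSq_eq_norm_mul_self,
          Quaternion.normSq_def']
        simp
      rw [← hinv _ hn x, inv_of_norm_one hn]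
      congr 2
      have e1 : Real.cos s = Real.cos (s/2)^2 - Real.sin (s/2)^2 := by
        rw [← Real.cos_two_mul']; ring_nf
      have e2 : Real.sin s = 2 * Real.sin (s/2) * Real.cos (s/2) := by
        rw [← Real.sin_two_mul]; ring_nf
      have e3 := Real.sin_sq_add_cos_sq (s/2)
      ext i
      fin_cases i <;> simp [γ, coords, e1, e2]
      · linear_combination (-x.re) * e3
      · ring
      · ring
      · linear_combination (-x.imK) * e3
    have hd := hasDerivAt_evalP f γ ![0, x.imJ, -x.imI, 0] 0 (by
      intro i
      fin_cases i
      · simpa [γ] using hasDerivAt_const (0:ℝ) x.re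
      · simpa [γ] using deriv_trig_add x.imI x.imJ
      · simpa [γ] using deriv_trig_sub x.imJ x.imI
      · simpa [γ] using hasDerivAt_const (0:ℝ) x.imK)
    simp only [hγ] at hd
    have := hd.unique (hasDerivAt_const (0:ℝ) _)
    have g0 : γ 0 = coords x := by ext i; fin_cases i <;> simp [γ, coords]
    rw [g0] at this
    simp [Fin.sum_univ_four] at this
    simp [coords] at this ⊢
    linarith
  · rw [← sub_eq_zero]
    apply poly_zero_of
    intro x
    let γ : ℝ → Fin 4 → ℝ := fun s => ![x.re, x.imI * Real.cos s + x.imK * Real.sin s,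
      x.imJ, x.imK * Real.cos s - x.imI * Real.sin s]
    have hγ : ∀ s, eval (γ s) f = eval (coords x) f := by
      intro s
      have hn : ‖(mkH (Real.cos (s/2)) 0 (-Real.sin (s/2)) 0)‖ = 1 := by
        rw [← sq_eq_sq₀ (norm_nonneg _) zero_le_one, sq, ← Quaternion.normSq_eq_norm_mul_self,
          Quaternion.normSq_def']
        simp
      rw [← hinv _ hn x, inv_of_norm_one hn]
      congr 2
      have e1 : Real.cos s = Real.cos (s/2)^2 - Real.sin (s/2)^2 := by
        rw [← Real.cos_two_mul']; ring_nf
      have e2 : Real.sin s = 2 * Real.sin (s/2) * Real.cos (s/2) := by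
        rw [← Real.sin_two_mul]; ring_nf
      have e3 := Real.sin_sq_add_cos_sq (s/2)
      ext i
      fin_cases i <;> simp [γ, coords, e1, e2]
      · linear_combination (-x.re) * e3
      · ring
      · linear_combination (-x.imJ) * e3
      · ring
    have hd := hasDerivAt_evalP f γ ![0, x.imK, 0, -x.imI] 0 (by
      intro i
      fin_cases i
      · simpa [γ] using hasDerivAt_const (0:ℝ) x.re
      · simpa [γ] using deriv_trig_add x.imI x.imK
      · simpa [γ] using hasDerivAt_const (0:ℝ) x.imJ
      · simpa [γ] using deriv_trig_sub x.imK x.imI)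
    simp only [hγ] at hd
    have := hd.unique (hasDerivAt_const (0:ℝ) _)
    have g0 : γ 0 = coords x := by ext i; fin_cases i <;> simp [γ, coords]
    rw [g0] at this
    simp [Fin.sum_univ_four] at this
    simp [coords] at this ⊢
    linarith

lemma conj_to_plane (x : ℍ[ℝ]) : ∃ (b : ℝ) (t : ℍ[ℝ]), ‖t‖ = 1 ∧
    t⁻¹ * x * t = (mkH x.re b 0 0) := by
  suffices h : ∃ (b : ℝ) (t : ℍ[ℝ]), t ≠ 0 ∧ x * t = t * (mkH x.re b 0 0) by
    obtain ⟨b, t, ht, h⟩ := h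
    have hn : ‖t‖ ≠ 0 := norm_ne_zero_iff.mpr ht
    refine ⟨b, ‖t‖⁻¹ • t, ?_, ?_⟩
    · rw [norm_smul]; simp [hn]
    · have ht' : ‖t‖⁻¹ • t ≠ 0 := smul_ne_zero (inv_ne_zero hn) ht
      rw [mul_assoc, inv_mul_eq_iff_eq_mul₀ ht', mul_smul_comm, h, smul_mul_assoc]
  by_cases hv : x.imJ = 0 ∧ x.imK = 0
  · refine ⟨x.imI, 1, one_ne_zero, ?_⟩
    apply Quaternion.ext <;> simp [hv.1, hv.2]
  · have hb := Real.sq_sqrt (show 0 ≤ x.imI ^ 2 + x.imJ ^ 2 + x.imK ^ 2 by positivity)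
    set b := Real.sqrt (x.imI ^ 2 + x.imJ ^ 2 + x.imK ^ 2)
    refine ⟨b, (mkH 0 (x.imI + b) x.imJ x.imK), ?_, ?_⟩
    · intro h
      apply hv
      exact ⟨congrArg QuaternionAlgebra.imJ h, congrArg QuaternionAlgebra.imK h⟩
    · apply Quaternion.ext <;> simp <;> first | linear_combination hb | ring

lemma zonal_zero {k : ℕ} {f : MvPolynomial (Fin 4) ℝ} (hf : f.IsHomogeneous k)
    (hΔ : (∑ i : Fin 4, pderiv i (pderiv i f)) = 0)
    (hinv : ∀ t : ℍ[ℝ], ‖t‖ = 1 → ∀ x, eval (coords (t⁻¹ * x * t)) f = eval (coords x) f)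
    (h1 : eval (coords 1) f = 0) : f = 0 := by
  obtain ⟨h12, h13⟩ := inf_inv hinv
  have hl := lineP_zero hf hΔ h12 h13 h1
  have : X 0 * f = 0 := by
    apply poly_zero_of
    intro x
    rw [map_mul, eval_X]
    by_cases h0 : x.re = 0
    · simp [coords, h0]
    · obtain ⟨b, t, ht, h⟩ := conj_to_plane x
      rw [← hinv t ht x, h]
      have e : (mkH x.re b 0 0) = x.re • (mkH 1 (b / x.re) 0 0) := by
        apply Quaternion.ext <;> simp
        field_simp
      rw [e, coords_smul, eval_smulP hf, ← eval_lineP, hl]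
      simp
  exact (mul_eq_zero.mp this).resolve_left (X_ne_zero 0)

lemma coords_add (x y : ℍ[ℝ]) : coords (x + y) = coords x + coords y := by
  ext i; fin_cases i <;> simp [coords]

lemma coords_inj {x y : ℍ[ℝ]} (h : ∀ c, coords x c = coords y c) : x = y := by
  apply Quaternion.ext
  · exact h 0
  · exact h 1
  · exact h 2
  · exact h 3

lemma coords_zero : coords 0 = 0 := by
  ext i; fin_cases i <;> simp [coords]

/-- `V_k` as a submodule. -/
def VkSub (k : ℕ) : Submodule ℝ (ℍ[ℝ] → ℍ[ℝ]) where
  carrier := VkSet k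
  add_mem' := by
    intro σ τ hσ hτ c
    obtain ⟨P, h1, h2, h3⟩ := hσ c
    obtain ⟨Q, g1, g2, g3⟩ := hτ c
    refine ⟨P + Q, h1.add g1, ?_, fun x => ?_⟩
    · simp only [map_add, Finset.sum_add_distrib, h2, g2, add_zero]
    · simp [h3, g3, coords_add]
  zero_mem' := by
    intro c
    exact ⟨0, isHomogeneous_zero _ _ _, by simp, fun x => by simp [coords_zero]⟩
  smul_mem' := by
    intro r σ hσ c
    obtain ⟨P, h1, h2, h3⟩ := hσ c
    refine ⟨C r * P, h1.C_mul r, ?_, fun x => ?_⟩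
    · simp only [Derivation.leibniz, pderiv_C, smul_eq_mul, mul_zero, add_zero,
        ← Finset.mul_sum, h2]
    · simp [h3, coords_smul]

lemma mem_VkSub {k : ℕ} {σ : ℍ[ℝ] → ℍ[ℝ]} : σ ∈ VkSub k ↔ memVk k σ := Iff.rfl

lemma memVk_mul {k : ℕ} {σ : ℍ[ℝ] → ℍ[ℝ]} (h : memVk k σ) (q : ℍ[ℝ]) :
    memVk k (fun x => σ x * q) := by
  choose P h1 h2 h3 using h
  intro c
  refine ⟨∑ j, C (Rmat q c j) * P j, IsHomogeneous.sum _ _ _ fun j _ => (h1 j).C_mul _, ?_, ?_⟩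
  · simp only [map_sum, Derivation.leibniz, pderiv_C, smul_eq_mul, mul_zero, add_zero]
    rw [Finset.sum_comm]
    simp only [← Finset.mul_sum, h2, mul_zero, Finset.sum_const_zero]
  · intro x
    rw [← Rmat_mulVec]
    simp [h3, Matrix.mulVec, dotProduct]

lemma continuous_coords : Continuous coords := by
  refine continuous_pi fun i => ?_
  fin_cases i
  · exact Quaternion.continuous_re
  · exact Quaternion.continuous_imI
  · exact Quaternion.continuous_imJ
  · exact Quaternion.continuous_imK

lemma memVk.cont {k : ℕ} {σ : ℍ[ℝ] → ℍ[ℝ]} (h : memVk k σ) (c : Fin 4) :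
    Continuous fun x => coords (σ x) c := by
  obtain ⟨P, -, -, h3⟩ := h c
  simp only [← h3]
  exact (MvPolynomial.continuous_eval P).comp continuous_coords

lemma memVk.hom {k : ℕ} {σ : ℍ[ℝ] → ℍ[ℝ]} (h : memVk k σ) (r : ℝ) (x : ℍ[ℝ]) :
    σ (r • x) = r ^ k • σ x := by
  apply coords_inj
  intro c
  obtain ⟨P, h1, -, h3⟩ := h c
  rw [← h3, coords_smul, eval_smulP h1, coords_smul, h3]

lemma memVk.zonal {k : ℕ} {σ : ℍ[ℝ] → ℍ[ℝ]} (h : memVk k σ)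
    (hinv : ∀ t : ℍ[ℝ], ‖t‖ = 1 → ∀ x, σ (t⁻¹ * x * t) = σ x) (h1 : σ 1 = 0) : σ = 0 := by
  ext1 x
  apply coords_inj
  intro c
  obtain ⟨P, h2, h3, h4⟩ := h c
  rw [← h4, zonal_zero h2 h3 (fun t ht x => by rw [h4, h4, hinv t ht]) (by simp [h4, h1, coords_zero])]
  simp [coords_zero]

instance finite_VkSub (k : ℕ) : Module.Finite ℝ (VkSub k) := by
  haveI : Module.Finite ℝ (homogeneousSubmodule (Fin 4) ℝ k) :=
    Module.Finite.iff_fg.mpr (homogeneousSubmodule_fg (Fin 4) ℝ k)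
  let Φ : (Fin 4 → homogeneousSubmodule (Fin 4) ℝ k) →ₗ[ℝ] (ℍ[ℝ] → ℍ[ℝ]) :=
    { toFun := fun P x => mkH (eval (coords x) (P 0).1) (eval (coords x) (P 1).1)
        (eval (coords x) (P 2).1) (eval (coords x) (P 3).1)
      map_add' := by
        intro P Q
        ext1 x
        apply Quaternion.ext <;> simp
      map_smul' := by
        intro r P
        ext1 x
        apply Quaternion.ext <;> simp [smul_eval] }
  have hle : VkSub k ≤ LinearMap.range Φ := by
    intro σ hσ
    choose P h1 h2 h3 using (mem_VkSub.mp hσ)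
    refine ⟨fun c => ⟨P c, h1 c⟩, ?_⟩
    ext1 x
    apply Quaternion.ext
    · exact h3 0 x
    · exact h3 1 x
    · exact h3 2 x
    · exact h3 3 x
  exact Submodule.finiteDimensional_of_le hle

instance measH : MeasurableSpace ℍ[ℝ] := borel _
instance borelH : BorelSpace ℍ[ℝ] := ⟨rfl⟩

def rho (x : ℍ[ℝ]) : ℝ := max 0 (1 - ‖x‖)

lemma rho_cont : Continuous rho := by unfold rho; fun_prop

lemma rho_supp : HasCompactSupport rho := by
  apply HasCompactSupport.intro (isCompact_closedBall (0 : ℍ[ℝ]) 1)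
  intro x hx
  simp at hx
  simp [rho]
  linarith

def dotH (a b : ℍ[ℝ]) : ℝ := ∑ c, coords a c * coords b c

/-- invariant inner product -/
def Bf (σ τ : ℍ[ℝ] → ℍ[ℝ]) : ℝ := ∫ x, rho x * dotH (σ x) (τ x)

lemma Bf_comm (σ τ : ℍ[ℝ] → ℍ[ℝ]) : Bf σ τ = Bf τ σ := by
  simp [Bf, dotH, mul_comm]

lemma integrand_cont {k : ℕ} {σ τ : ℍ[ℝ] → ℍ[ℝ]} (hσ : memVk k σ) (hτ : memVk k τ) :
    Continuous fun x => rho x * dotH (σ x) (τ x) := by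
  refine rho_cont.mul ?_
  unfold dotH
  exact continuous_finsetSum _ fun c _ => (hσ.cont c).mul (hτ.cont c)

lemma integrand_int {k : ℕ} {σ τ : ℍ[ℝ] → ℍ[ℝ]} (hσ : memVk k σ) (hτ : memVk k τ) :
    MeasureTheory.Integrable fun x => rho x * dotH (σ x) (τ x) :=
  (integrand_cont hσ hτ).integrable_of_hasCompactSupport rho_supp.mul_right

lemma Bf_add {k : ℕ} {σ σ' τ : ℍ[ℝ] → ℍ[ℝ]} (hσ : memVk k σ) (hσ' : memVk k σ')
    (hτ : memVk k τ) : Bf (σ + σ') τ = Bf σ τ + Bf σ' τ := by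
  unfold Bf
  rw [← MeasureTheory.integral_add (integrand_int hσ hτ) (integrand_int hσ' hτ)]
  congr 1
  ext x
  simp [dotH, coords_add, add_mul, mul_add, Finset.sum_add_distrib]

lemma Bf_smul (r : ℝ) (σ τ : ℍ[ℝ] → ℍ[ℝ]) : Bf (r • σ) τ = r * Bf σ τ := by
  unfold Bf
  rw [← MeasureTheory.integral_const_mul]
  congr 1
  ext x
  simp only [dotH, Pi.smul_apply, coords_smul, Finset.mul_sum]
  exact Finset.sum_congr rfl fun c _ => by ring

lemma Bf_add_right {k : ℕ} {σ σ' τ : ℍ[ℝ] → ℍ[ℝ]} (hσ : memVk k σ) (hσ' : memVk k σ')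
    (hτ : memVk k τ) : Bf τ (σ + σ') = Bf τ σ + Bf τ σ' := by
  rw [Bf_comm, Bf_add hσ hσ' hτ, Bf_comm σ, Bf_comm σ']

lemma Bf_smul_right (r : ℝ) (σ τ : ℍ[ℝ] → ℍ[ℝ]) : Bf τ (r • σ) = r * Bf τ σ := by
  rw [Bf_comm, Bf_smul, Bf_comm]

lemma Bf_sub_right {k : ℕ} {σ σ' τ : ℍ[ℝ] → ℍ[ℝ]} (hσ : memVk k σ) (hσ' : memVk k σ')
    (hτ : memVk k τ) : Bf τ (σ - σ') = Bf τ σ - Bf τ σ' := by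
  have h := (VkSub k).sub_mem (x := σ) (y := σ') hσ hσ'
  have := Bf_add_right (mem_VkSub.mp h) hσ' hτ
  rw [sub_add_cancel] at this
  linarith

lemma Bf_def {k : ℕ} {σ : ℍ[ℝ] → ℍ[ℝ]} (hσ : memVk k σ) (h : Bf σ σ = 0) : σ = 0 := by
  by_contra hne
  obtain ⟨x, hx⟩ := Function.ne_iff.mp hne
  simp only [Pi.zero_apply] at hx
  have hd : ∀ a : ℍ[ℝ], 0 ≤ dotH a a := fun a =>
    Finset.sum_nonneg fun c _ => mul_self_nonneg _
  have hd0 : ∀ a : ℍ[ℝ], dotH a a = 0 → a = 0 := by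
    intro a ha
    apply coords_inj
    intro c
    have := (Finset.sum_eq_zero_iff_of_nonneg (fun c _ => mul_self_nonneg (coords a c))).mp ha c
      (Finset.mem_univ _)
    simpa [coords_zero] using this
  have hr : 0 < 1 + ‖x‖ := by positivity
  have hpos := (integrand_cont hσ hσ).integral_pos_of_hasCompactSupport_nonneg_nonzero
    (μ := MeasureTheory.volume) rho_supp.mul_right
    (fun y => mul_nonneg (le_max_left _ _) (hd _)) (x := (1 + ‖x‖)⁻¹ • x) (by
      apply mul_ne_zero
      · have : ‖(1 + ‖x‖)⁻¹ • x‖ < 1 := by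
          rw [norm_smul, norm_inv, Real.norm_of_nonneg hr.le, inv_mul_lt_iff₀ hr]
          linarith
        unfold rho
        exact (lt_max_of_lt_right (by linarith)).ne'
      · intro h0
        have := hd0 _ h0
        rw [hσ.hom] at this
        exact hx ((smul_eq_zero.mp this).resolve_left (by positivity)))
  exact hpos.ne' h

lemma Bf_mul (σ τ : ℍ[ℝ] → ℍ[ℝ]) (q : ℍ[ℝ]) :
    Bf σ (fun x => τ x * q) = Bf (fun x => σ x * star q) τ := by
  unfold Bf
  congr 1
  ext x
  congr 1
  simp [dotH, coords, Fin.sum_univ_four]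
  ring

def isoH {s t : ℍ[ℝ]} (hs : ‖s‖ = 1) (ht : ‖t‖ = 1) : ℍ[ℝ] ≃ₗᵢ[ℝ] ℍ[ℝ] where
  toFun x := t⁻¹ * x * s
  invFun x := t * x * s⁻¹
  map_add' x y := by rw [mul_add, add_mul]
  map_smul' r x := by simp
  left_inv x := by
    have h1 : s ≠ 0 := by rintro rfl; simp at hs
    have h2 : t ≠ 0 := by rintro rfl; simp at ht
    simp only [mul_assoc, mul_inv_cancel₀ h1, mul_one, mul_inv_cancel_left₀ h2]
  right_inv x := by
    have h1 : s ≠ 0 := by rintro rfl; simp at hs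
    have h2 : t ≠ 0 := by rintro rfl; simp at ht
    simp only [mul_assoc, inv_mul_cancel₀ h1, mul_one, inv_mul_cancel_left₀ h2]
  norm_map' x := by
    change ‖t⁻¹ * x * s‖ = ‖x‖
    simp [hs, ht]

lemma Bf_trans (σ τ : ℍ[ℝ] → ℍ[ℝ]) {s t : ℍ[ℝ]} (hs : ‖s‖ = 1) (ht : ‖t‖ = 1) :
    Bf σ (fun x => τ (t⁻¹ * x * s)) = Bf (fun x => σ ((t⁻¹)⁻¹ * x * s⁻¹)) τ := by
  have hm := (isoH hs ht).measurePreserving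
  have := hm.integral_comp (isoH hs ht).toHomeomorph.measurableEmbedding
    (fun x => rho x * dotH (σ ((t⁻¹)⁻¹ * x * s⁻¹)) (τ x))
  unfold Bf
  rw [← this]
  congr 1
  ext x
  have e2 : (t⁻¹)⁻¹ * (isoH hs ht x) * s⁻¹ = x := by
    rw [inv_inv]; exact (isoH hs ht).symm_apply_apply x
  have e3 : rho (isoH hs ht x) = rho x := by simp [rho]
  rw [e2, e3]
  rfl

lemma riesz {k : ℕ} {W : Submodule ℝ (ℍ[ℝ] → ℍ[ℝ])} (hW : W ≤ VkSub k) (φ : W →ₗ[ℝ] ℝ) :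
    ∃ w : W, ∀ σ : W, Bf σ.1 w.1 = φ σ := by
  haveI : FiniteDimensional ℝ W := Submodule.finiteDimensional_of_le hW
  let T : W →ₗ[ℝ] Module.Dual ℝ W := LinearMap.mk₂ ℝ (fun w σ => Bf σ.1 w.1)
    (fun w w' σ => Bf_add_right (hW w.2) (hW w'.2) (hW σ.2))
    (fun r w σ => Bf_smul_right r w.1 σ.1)
    (fun w σ σ' => Bf_add (hW σ.2) (hW σ'.2) (hW w.2))
    (fun r w σ => Bf_smul r σ.1 w.1)
  have hinj : Function.Injective T := by
    rw [← LinearMap.ker_eq_bot, LinearMap.ker_eq_bot']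
    intro w hw
    have : Bf w.1 w.1 = 0 := LinearMap.congr_fun hw w
    exact Subtype.ext (Bf_def (hW w.2) this)
  have hsurj := (LinearMap.injective_iff_surjective_of_finrank_eq_finrank
    (Subspace.dual_finrank_eq (K := ℝ) (V := W)).symm).mp hinj
  obtain ⟨w, hw⟩ := hsurj φ
  exact ⟨w, fun σ => LinearMap.congr_fun hw σ⟩

lemma exists_zonal {k : ℕ} {W : Submodule ℝ (ℍ[ℝ] → ℍ[ℝ])} (hW : W ≤ VkSub k)
    (hq : ∀ σ ∈ W, ∀ q : ℍ[ℝ], (fun x => σ x * q) ∈ W)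
    (htrans : ∀ s t : ℍ[ℝ], ‖s‖ = 1 → ‖t‖ = 1 →
      ∀ σ ∈ W, (fun x => σ (t⁻¹ * x * s)) ∈ W) {σ : ℍ[ℝ] → ℍ[ℝ]} (hσ : σ ∈ W) (hσ0 : σ ≠ 0) :
    ∃ w ∈ W, w ≠ 0 ∧ ∀ t : ℍ[ℝ], ‖t‖ = 1 → ∀ x, w (t⁻¹ * x * t) = w x := by
  -- an element whose value at 1 has non-zero real part
  obtain ⟨τ, hτ, hτ1⟩ : ∃ τ ∈ W, (τ 1).re ≠ 0 := by
    obtain ⟨x, hx⟩ := Function.ne_iff.mp hσ0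
    simp only [Pi.zero_apply] at hx
    obtain ⟨r, u, hu, rfl⟩ : ∃ (r : ℝ) (u : ℍ[ℝ]), ‖u‖ = 1 ∧ x = r • u := by
      by_cases h0 : x = 0
      · exact ⟨0, 1, by simp, by simp [h0]⟩
      · have hn : ‖x‖ ≠ 0 := norm_ne_zero_iff.mpr h0
        refine ⟨‖x‖, ‖x‖⁻¹ • x, by rw [norm_smul]; simp [hn], ?_⟩
        rw [smul_smul, mul_inv_cancel₀ hn, one_smul]
    rw [memVk.hom (hW hσ)] at hx
    have hu0 : σ u ≠ 0 := fun h => hx (by rw [h, smul_zero])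
    refine ⟨_, hq _ (htrans u 1 hu (by simp) σ hσ) (σ u)⁻¹, ?_⟩
    simp [mul_inv_cancel₀ hu0]
  let φ : W →ₗ[ℝ] ℝ :=
    { toFun := fun σ => (σ.1 1).re
      map_add' := fun a b => by simp
      map_smul' := fun r a => by simp }
  obtain ⟨w, hw⟩ := riesz hW φ
  refine ⟨w.1, w.2, ?_, ?_⟩
  · intro h0
    have := hw ⟨τ, hτ⟩
    rw [h0] at this
    apply hτ1
    change Bf τ 0 = (τ 1).re at this
    rw [← this]
    simp [Bf, dotH, coords_zero]
  · intro t ht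
    have hti : ‖t⁻¹‖ = 1 := by simp [ht]
    have ht0 : t ≠ 0 := by rintro rfl; simp at ht
    have hmem := htrans t t ht ht w.1 w.2
    have key : ∀ a ∈ W, Bf a (fun x => w.1 (t⁻¹ * x * t)) = Bf a w.1 := by
      intro a ha
      rw [Bf_trans _ _ ht ht, hw ⟨_, htrans _ _ hti hti a ha⟩, hw ⟨a, ha⟩]
      change (a ((t⁻¹)⁻¹ * 1 * t⁻¹)).re = (a 1).re
      rw [inv_inv, mul_one, mul_inv_cancel₀ ht0]
    have hd := W.sub_mem hmem w.2
    have hz := Bf_sub_right (hW hmem) (hW w.2) (hW hd)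
    rw [key _ hd, sub_self] at hz
    have := Bf_def (hW hd) hz
    intro x
    have := congrFun this x
    simpa [sub_eq_zero] using this

/-- Irreducibility of the two-sided translation representation on `V_k` as a quaternionic
representation: any real subspace `W ⊆ V_k` that is stable under pointwise right
quaternionic multiplication and under two-sided translations by unit quaternions is
`{0}` or all of `V_k`. -/
theorem Vk_irreducible (k : ℕ) (W : Submodule ℝ (ℍ[ℝ] → ℍ[ℝ]))
    (hWV : (W : Set (ℍ[ℝ] → ℍ[ℝ])) ⊆ VkSet k)
    (hq : ∀ σ ∈ W, ∀ q : ℍ[ℝ], (fun x => σ x * q) ∈ W)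
    (htrans : ∀ s t : ℍ[ℝ], ‖s‖ = 1 → ‖t‖ = 1 →
      ∀ σ ∈ W, (fun x => σ (t⁻¹ * x * s)) ∈ W) :
    (W : Set (ℍ[ℝ] → ℍ[ℝ])) = {0} ∨ (W : Set (ℍ[ℝ] → ℍ[ℝ])) = VkSet k := by
  by_cases h0 : (W : Set (ℍ[ℝ] → ℍ[ℝ])) = {0}
  · exact Or.inl h0
  refine Or.inr (Set.Subset.antisymm hWV ?_)
  have hW : W ≤ VkSub k := hWV
  obtain ⟨σ₀, hσ₀, hσ₀0⟩ : ∃ σ ∈ W, σ ≠ 0 := by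
    by_contra hcon
    push Not at hcon
    apply h0
    ext σ
    constructor
    · intro h
      exact hcon σ h
    · rintro rfl
      exact W.zero_mem
  obtain ⟨w₁, hw₁, hw₁0, hz₁⟩ := exists_zonal hW hq htrans hσ₀ hσ₀0
  -- the orthogonal complement
  let U : Submodule ℝ (ℍ[ℝ] → ℍ[ℝ]) :=
    { carrier := {τ | τ ∈ VkSub k ∧ ∀ σ ∈ W, Bf σ τ = 0}
      add_mem' := by
        rintro a b ⟨ha, ha'⟩ ⟨hb, hb'⟩
        refine ⟨add_mem ha hb, fun σ hσ => ?_⟩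
        rw [Bf_add_right ha hb (hW hσ), ha' σ hσ, hb' σ hσ, add_zero]
      zero_mem' := ⟨zero_mem _, fun σ _ => by simp [Bf, dotH, coords_zero]⟩
      smul_mem' := by
        rintro r a ⟨ha, ha'⟩
        refine ⟨Submodule.smul_mem _ r ha, fun σ hσ => ?_⟩
        rw [Bf_smul_right, ha' σ hσ, mul_zero] }
  have hU : U ≤ VkSub k := fun τ h => h.1
  intro σ hσ
  have hσ' : σ ∈ VkSub k := hσ
  let φ : W →ₗ[ℝ] ℝ :=
    { toFun := fun a => Bf a.1 σ
      map_add' := fun a b => Bf_add (hW a.2) (hW b.2) hσ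
      map_smul' := fun r a => Bf_smul r a.1 σ }
  obtain ⟨w, hw⟩ := riesz hW φ
  have hu : σ - w.1 ∈ U := by
    refine ⟨sub_mem hσ' (hW w.2), fun a ha => ?_⟩
    rw [Bf_sub_right hσ (hW w.2) (hW ha), hw ⟨a, ha⟩]
    exact sub_self _
  by_cases hne : σ - w.1 = 0
  · rw [sub_eq_zero.mp hne]
    exact w.2
  exfalso
  obtain ⟨w₂, hw₂, hw₂0, hz₂⟩ := exists_zonal hU
    (fun τ hτ q => ⟨memVk_mul hτ.1 q, fun a ha => by
      rw [Bf_mul]; exact hτ.2 _ (hq a ha _)⟩)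
    (fun s t hs ht τ hτ => ⟨memVk_trans hτ.1 hs ht, fun a ha => by
      rw [Bf_trans _ _ hs ht]
      exact hτ.2 _ (htrans _ _ (by simp [hs]) (by simp [ht]) a ha)⟩) hu hne
  have h1 : w₁ 1 ≠ 0 := fun h => hw₁0 (memVk.zonal (hW hw₁) hz₁ h)
  have hmem := hq w₁ hw₁ ((w₁ 1)⁻¹ * w₂ 1)
  have heq : (fun x => w₁ x * ((w₁ 1)⁻¹ * w₂ 1)) - w₂ = 0 := by
    refine memVk.zonal (k := k) (sub_mem (hW hmem) (hU hw₂)) ?_ ?_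
    · intro t ht x
      simp only [Pi.sub_apply, hz₁ t ht, hz₂ t ht]
    · simp only [Pi.sub_apply]
      rw [mul_inv_cancel_left₀ h1, sub_self]
  rw [sub_eq_zero] at heq
  rw [heq] at hmem
  exact hw₂0 (Bf_def (hU hw₂) (hw₂.2 w₂ hmem))

end
end

section
/- For every natural number k, the (k+1)² functions F_{p,q} : ℍ → ℂ (p, q ∈ {0, …, k}) defined by F_{p,q}(x) = C(k,p)⁻¹ · C(k,q)⁻¹ · √((k+1)/(2π²)) · Σ_i [k! / ((k−q−i)!·(p−i)!·i!·(q−p+i)!)] · z₂(x)^{k−q−i} · conj(z₂(x))^{p−i} · (−z₁(x))^{i} · conj(z₁(x))^{q−p+i}, where C(k,p) is the binomial coefficient and the sum runs over those integers i ≥ 0 for which all four exponents k−q−i, p−i, i, q−p+i are nonnegative, are harmonic homogeneous polynomials of degree k; they form a ℂ-basis of W_k and are pairwise orthogonal in L²(S³, ν). -/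
open Quaternion MvPolynomial MeasureTheory Real

noncomputable section

/-- The complex coordinate `z₁(x) = x₀ + x₁·𝕚`. -/
def z1 (x : ℍ[ℝ]) : ℂ := (x.re : ℂ) + (x.imI : ℂ) * Complex.I

/-- The complex coordinate `z₂(x) = x₂ + x₃·𝕚`. -/
def z2 (x : ℍ[ℝ]) : ℂ := (x.imJ : ℂ) + (x.imK : ℂ) * Complex.I

/-- The four real coordinates of a quaternion, viewed in `ℂ`. -/
def coordsC (x : ℍ[ℝ]) : Fin 4 → ℂ := ![(x.re : ℂ), (x.imI : ℂ), (x.imJ : ℂ), (x.imK : ℂ)]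

/-- `f ∈ W_k`: `f` is (given by) a `ℂ`-valued polynomial on `ℝ⁴ ≅ ℍ`, homogeneous of
degree `k` and harmonic. -/
def memWk (k : ℕ) (f : ℍ[ℝ] → ℂ) : Prop :=
  ∃ P : MvPolynomial (Fin 4) ℂ,
    P.IsHomogeneous k ∧ (∑ i : Fin 4, pderiv i (pderiv i P)) = 0 ∧
    ∀ x : ℍ[ℝ], eval (coordsC x) P = f x

/-- The function `F_{p,q}` of Theorem `ds3basis`. The sum runs over those `i ≥ 0` for
which all four exponents `k−q−i`, `p−i`, `i`, `q−p+i` are nonnegative. -/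
def Fpq (k : ℕ) (p q : Fin (k + 1)) : ℍ[ℝ] → ℂ := fun x =>
  ((k.choose p : ℂ))⁻¹ * ((k.choose q : ℂ))⁻¹ *
    ((Real.sqrt ((k + 1) / (2 * π ^ 2)) : ℝ) : ℂ) *
    ∑ i ∈ Finset.range (k + 1),
      if i ≤ (p : ℕ) ∧ (q : ℕ) + i ≤ k ∧ (p : ℕ) ≤ (q : ℕ) + i then
        (k.factorial : ℂ) /
            (((k - q - i).factorial : ℂ) * (((p : ℕ) - i).factorial : ℂ) *
              (i.factorial : ℂ) * (((q : ℕ) + i - p).factorial : ℂ)) *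
          (z2 x ^ (k - q - i) * (starRingEnd ℂ) (z2 x) ^ ((p : ℕ) - i) *
            (-z1 x) ^ i * (starRingEnd ℂ) (z1 x) ^ ((q : ℕ) + i - p))
      else 0

/-- Chain rule for partial derivatives under polynomial substitution. -/
lemma pderiv_aeval_chain (f : Fin 4 → MvPolynomial (Fin 4) ℂ) (i : Fin 4)
    (P : MvPolynomial (Fin 4) ℂ) :
    pderiv i (aeval f P) = ∑ j, pderiv i (f j) * aeval f (pderiv j P) := by
  induction P using MvPolynomial.induction_on with
  | C a => simp
  | add p q hp hq => simp only [map_add, hp, hq, mul_add, Finset.sum_add_distrib]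
  | mul_X p n h =>
    simp only [map_mul, aeval_X, Derivation.leibniz, smul_eq_mul, h, map_add, pderiv_X,
      mul_add, Finset.sum_add_distrib]
    have h1 : ∑ j, pderiv i (f j) * (aeval f p * aeval f (Pi.single (M := fun _ =>
        MvPolynomial (Fin 4) ℂ) j 1 n)) = aeval f p * pderiv i (f n) := by
      rw [Finset.sum_eq_single n]
      · simp [mul_comm]
      · intro b _ hb
        simp [hb.symm]
      · simp
    rw [h1, Finset.mul_sum]
    refine congrArg₂ (· + ·) rfl (Finset.sum_congr rfl fun j _ => ?_)
    exact mul_left_comm _ _ _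

/-- complex coordinates in terms of the real ones -/
def toW : Fin 4 → MvPolynomial (Fin 4) ℂ :=
  ![X 0 + C Complex.I * X 1, X 0 - C Complex.I * X 1,
    X 2 + C Complex.I * X 3, X 2 - C Complex.I * X 3]

/-- real coordinates in terms of the complex ones -/
def toX : Fin 4 → MvPolynomial (Fin 4) ℂ :=
  ![C (1/2) * (X 0 + X 1), C (-Complex.I/2) * (X 0 - X 1),
    C (1/2) * (X 2 + X 3), C (-Complex.I/2) * (X 2 - X 3)]

/-- the values of the complex coordinates -/
def wc (x : ℍ[ℝ]) : Fin 4 → ℂ :=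
  ![z1 x, (starRingEnd ℂ) (z1 x), z2 x, (starRingEnd ℂ) (z2 x)]

lemma eval_toW (x : ℍ[ℝ]) (G : MvPolynomial (Fin 4) ℂ) :
    eval (coordsC x) (aeval toW G) = eval (wc x) G := by
  induction G using MvPolynomial.induction_on with
  | C a => simp
  | add p q hp hq => simp only [map_add, hp, hq]
  | mul_X p n h =>
    simp only [map_mul, h, aeval_X, eval_X]
    congr 1
    fin_cases n <;> simp [toW, wc, coordsC, z1, z2] <;> ring

lemma eval_toX (x : ℍ[ℝ]) (G : MvPolynomial (Fin 4) ℂ) :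
    eval (wc x) (aeval toX G) = eval (coordsC x) G := by
  induction G using MvPolynomial.induction_on with
  | C a => simp
  | add p q hp hq => simp only [map_add, hp, hq]
  | mul_X p n h =>
    simp only [map_mul, h, aeval_X, eval_X]
    congr 1
    fin_cases n <;> simp [toX, wc, coordsC, z1, z2] <;> ring_nf <;> simp

lemma toX_toW (G : MvPolynomial (Fin 4) ℂ) : aeval toX (aeval toW G) = G := by
  have hI : (C Complex.I * C (-Complex.I / 2) : MvPolynomial (Fin 4) ℂ) = C (1/2) := by
    rw [← C_mul]; congr 1; linear_combination (-1/2) * Complex.I_mul_I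
  have hh : (C (1/2) + C (1/2) : MvPolynomial (Fin 4) ℂ) = 1 := by
    rw [← C_add]; norm_num
  induction G using MvPolynomial.induction_on with
  | C a => simp
  | add p q hp hq => simp only [map_add, hp, hq]
  | mul_X p n h =>
    simp only [map_mul, h, aeval_X]
    congr 1
    fin_cases n
    · simp [toW, toX, -map_div₀, -one_div, algebraMap_eq]
      linear_combination (X 0 - X 1) * hI + X 0 * hh
    · simp [toW, toX, -map_div₀, -one_div, algebraMap_eq]
      linear_combination -(X 0 - X 1) * hI + X 1 * hh
    · simp [toW, toX, -map_div₀, -one_div, algebraMap_eq]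
      linear_combination (X 2 - X 3) * hI + X 2 * hh
    · simp [toW, toX, -map_div₀, -one_div, algebraMap_eq]
      linear_combination -(X 2 - X 3) * hI + X 3 * hh

lemma eq_zero_of_eval_coords (P : MvPolynomial (Fin 4) ℂ)
    (h : ∀ x : ℍ[ℝ], eval (coordsC x) P = 0) : P = 0 := by
  refine funext_set (fun _ => Set.range (fun r : ℝ => (r : ℂ))) (fun _ =>
    Set.infinite_range_of_injective Complex.ofReal_injective) fun x hx => ?_
  have hx' : ∀ i, ∃ r : ℝ, (r : ℂ) = x i := fun i => hx i (Set.mem_univ i)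
  choose r hr using hx'
  have := h ⟨r 0, r 1, r 2, r 3⟩
  have e : coordsC ⟨r 0, r 1, r 2, r 3⟩ = x := by
    funext i
    fin_cases i <;> simp [coordsC, hr]
  rw [e] at this
  simp [this]

lemma homog_toW {k : ℕ} {G : MvPolynomial (Fin 4) ℂ} (hG : G.IsHomogeneous k) :
    (aeval toW G).IsHomogeneous k := by
  have := hG.aeval toW (n := 1) (fun i => by
    fin_cases i
    · exact (isHomogeneous_X ℂ 0).add ((isHomogeneous_X ℂ 1).C_mul _)
    · exact (isHomogeneous_X ℂ 0).sub ((isHomogeneous_X ℂ 1).C_mul _)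
    · exact (isHomogeneous_X ℂ 2).add ((isHomogeneous_X ℂ 3).C_mul _)
    · exact (isHomogeneous_X ℂ 2).sub ((isHomogeneous_X ℂ 3).C_mul _))
  simpa using this

lemma homog_toX {k : ℕ} {G : MvPolynomial (Fin 4) ℂ} (hG : G.IsHomogeneous k) :
    (aeval toX G).IsHomogeneous k := by
  have := hG.aeval toX (n := 1) (fun i => by
    fin_cases i
    · exact ((isHomogeneous_X ℂ 0).add (isHomogeneous_X ℂ 1)).C_mul _
    · exact ((isHomogeneous_X ℂ 0).sub (isHomogeneous_X ℂ 1)).C_mul _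
    · exact ((isHomogeneous_X ℂ 2).add (isHomogeneous_X ℂ 3)).C_mul _
    · exact ((isHomogeneous_X ℂ 2).sub (isHomogeneous_X ℂ 3)).C_mul _)
  simpa using this

/-- a quarter of the Laplacian in complex coordinates -/
def lapW (G : MvPolynomial (Fin 4) ℂ) : MvPolynomial (Fin 4) ℂ :=
  pderiv 0 (pderiv 1 G) + pderiv 2 (pderiv 3 G)

lemma pd_comm (i j : Fin 4) (G : MvPolynomial (Fin 4) ℂ) :
    pderiv i (pderiv j G) = pderiv j (pderiv i G) := by
  ext m
  simp only [coeff_pderiv]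
  by_cases h : i = j
  · rw [h]
  · simp [h, Ne.symm h, add_right_comm]
    ring

lemma lap_toW (G : MvPolynomial (Fin 4) ℂ) :
    ∑ i : Fin 4, pderiv i (pderiv i (aeval toW G)) = 4 * aeval toW (lapW G) := by
  have hI : (C Complex.I * C Complex.I : MvPolynomial (Fin 4) ℂ) = -1 := by
    rw [← C_mul]; simp
  have d0 : ∀ G : MvPolynomial (Fin 4) ℂ,
      pderiv 0 (aeval toW G) = aeval toW (pderiv 0 G) + aeval toW (pderiv 1 G) := by
    intro G; rw [pderiv_aeval_chain, Fin.sum_univ_four]; simp [toW]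
  have d1 : ∀ G : MvPolynomial (Fin 4) ℂ, pderiv 1 (aeval toW G) =
      C Complex.I * (aeval toW (pderiv 0 G) - aeval toW (pderiv 1 G)) := by
    intro G; rw [pderiv_aeval_chain, Fin.sum_univ_four]; simp [toW]; ring
  have d2 : ∀ G : MvPolynomial (Fin 4) ℂ,
      pderiv 2 (aeval toW G) = aeval toW (pderiv 2 G) + aeval toW (pderiv 3 G) := by
    intro G; rw [pderiv_aeval_chain, Fin.sum_univ_four]; simp [toW]
  have d3 : ∀ G : MvPolynomial (Fin 4) ℂ, pderiv 3 (aeval toW G) =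
      C Complex.I * (aeval toW (pderiv 2 G) - aeval toW (pderiv 3 G)) := by
    intro G; rw [pderiv_aeval_chain, Fin.sum_univ_four]; simp [toW]; ring
  rw [Fin.sum_univ_four]
  simp only [d0, d1, d2, d3, map_add, map_sub, pderiv_C_mul, lapW]
  rw [pd_comm 1 0, pd_comm 3 2]
  generalize aeval toW (pderiv 0 (pderiv 0 G)) = a
  generalize aeval toW (pderiv 0 (pderiv 1 G)) = b
  generalize aeval toW (pderiv 1 (pderiv 1 G)) = c
  generalize aeval toW (pderiv 2 (pderiv 2 G)) = a'
  generalize aeval toW (pderiv 2 (pderiv 3 G)) = b'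
  generalize aeval toW (pderiv 3 (pderiv 3 G)) = c'
  linear_combination (a - 2 * b + c + a' - 2 * b' + c') * hI

lemma lap_toX (P : MvPolynomial (Fin 4) ℂ) :
    4 * lapW (aeval toX P) = aeval toX (∑ i : Fin 4, pderiv i (pderiv i P)) := by
  have hI : (C (-Complex.I / 2) * C (-Complex.I / 2) : MvPolynomial (Fin 4) ℂ) * 4 = -1 := by
    have : (4 : MvPolynomial (Fin 4) ℂ) = C 4 := (map_ofNat C 4).symm
    rw [this, ← C_mul, ← C_mul, ← C_1, ← C_neg]
    congr 1; linear_combination Complex.I_mul_I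
  have hh : (C (1 / 2) * C (1 / 2) : MvPolynomial (Fin 4) ℂ) * 4 = 1 := by
    have : (4 : MvPolynomial (Fin 4) ℂ) = C 4 := (map_ofNat C 4).symm
    rw [this, ← C_mul, ← C_mul, ← C_1]
    congr 1; norm_num
  have d0 : ∀ G : MvPolynomial (Fin 4) ℂ, pderiv 0 (aeval toX G) =
      C (1 / 2) * aeval toX (pderiv 0 G) + C (-Complex.I / 2) * aeval toX (pderiv 1 G) := by
    intro G; rw [pderiv_aeval_chain, Fin.sum_univ_four]; simp [toX]
  have d1 : ∀ G : MvPolynomial (Fin 4) ℂ, pderiv 1 (aeval toX G) =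
      C (1 / 2) * aeval toX (pderiv 0 G) - C (-Complex.I / 2) * aeval toX (pderiv 1 G) := by
    intro G; rw [pderiv_aeval_chain, Fin.sum_univ_four]; simp [toX]; try ring
  have d2 : ∀ G : MvPolynomial (Fin 4) ℂ, pderiv 2 (aeval toX G) =
      C (1 / 2) * aeval toX (pderiv 2 G) + C (-Complex.I / 2) * aeval toX (pderiv 3 G) := by
    intro G; rw [pderiv_aeval_chain, Fin.sum_univ_four]; simp [toX]
  have d3 : ∀ G : MvPolynomial (Fin 4) ℂ, pderiv 3 (aeval toX G) =
      C (1 / 2) * aeval toX (pderiv 2 G) - C (-Complex.I / 2) * aeval toX (pderiv 3 G) := by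
    intro G; rw [pderiv_aeval_chain, Fin.sum_univ_four]; simp [toX]; try ring
  rw [Fin.sum_univ_four]
  simp only [d0, d1, d2, d3, map_add, map_sub, pderiv_C_mul, lapW]
  rw [pd_comm 1 0, pd_comm 3 2]
  generalize aeval toX (pderiv 0 (pderiv 0 P)) = a
  generalize aeval toX (pderiv 0 (pderiv 1 P)) = b
  generalize aeval toX (pderiv 1 (pderiv 1 P)) = c
  generalize aeval toX (pderiv 2 (pderiv 2 P)) = a'
  generalize aeval toX (pderiv 2 (pderiv 3 P)) = b'
  generalize aeval toX (pderiv 3 (pderiv 3 P)) = c'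
  generalize (C (1 / 2) : MvPolynomial (Fin 4) ℂ) = h at *
  generalize (C (-Complex.I / 2) : MvPolynomial (Fin 4) ℂ) = g at *
  linear_combination (a + a') * hh - (c + c') * hI

/-- exponent vectors -/
def ex (c d a b : ℕ) : Fin 4 →₀ ℕ := Finsupp.equivFunOnFinite.symm ![c, d, a, b]

lemma ex_surj (m : Fin 4 →₀ ℕ) : m = ex (m 0) (m 1) (m 2) (m 3) := by
  ext i; fin_cases i <;> simp [ex]

lemma ex_inj {c d a b c' d' a' b' : ℕ} :
    ex c d a b = ex c' d' a' b' ↔ c = c' ∧ d = d' ∧ a = a' ∧ b = b' := by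
  constructor
  · intro h
    have h0 := DFunLike.congr_fun h 0
    have h1 := DFunLike.congr_fun h 1
    have h2 := DFunLike.congr_fun h 2
    have h3 := DFunLike.congr_fun h 3
    simp [ex] at h0 h1 h2 h3
    exact ⟨h0, h1, h2, h3⟩
  · rintro ⟨rfl, rfl, rfl, rfl⟩; rfl

lemma ex_degree (c d a b : ℕ) : (ex c d a b).degree = c + d + a + b := by
  rw [Finsupp.degree_eq_sum, Fin.sum_univ_four]; simp [ex]

lemma coeff_lapW (G : MvPolynomial (Fin 4) ℂ) (c d a b : ℕ) :
    coeff (ex c d a b) (lapW G) = coeff (ex (c + 1) (d + 1) a b) G * (c + 1) * (d + 1)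
      + coeff (ex c d (a + 1) (b + 1)) G * (a + 1) * (b + 1) := by
  have e1 : ex c d a b + Finsupp.single 0 1 + Finsupp.single 1 1 = ex (c + 1) (d + 1) a b := by
    ext i; rw [Finsupp.add_apply, Finsupp.add_apply]
    fin_cases i <;> simp [ex, Finsupp.single_apply]
  have e2 : ex c d a b + Finsupp.single 2 1 + Finsupp.single 3 1 = ex c d (a + 1) (b + 1) := by
    ext i; rw [Finsupp.add_apply, Finsupp.add_apply]
    fin_cases i <;> simp [ex, Finsupp.single_apply]
  simp only [lapW, coeff_add, coeff_pderiv, e1, e2]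
  simp [ex]
  ring

/-- unnormalised polynomial for `Fpq` in complex coordinates -/
def Gpq (k p q : ℕ) : MvPolynomial (Fin 4) ℂ :=
  ∑ i ∈ Finset.range (k + 1),
    if i ≤ p ∧ q + i ≤ k ∧ p ≤ q + i then
      monomial (ex i (q + i - p) (k - q - i) (p - i))
        ((-1) ^ i * ((k.factorial : ℂ) / (((k - q - i).factorial : ℂ) * ((p - i).factorial : ℂ) *
              (i.factorial : ℂ) * ((q + i - p).factorial : ℂ))))
    else 0

lemma coeff_Gpq (k p q c d a b : ℕ) : coeff (ex c d a b) (Gpq k p q) =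
    if c + b = p ∧ d + b = q ∧ c + d + a + b = k then
      (-1) ^ c * ((k.factorial : ℂ) / ((a.factorial : ℂ) * (b.factorial : ℂ) *
              (c.factorial : ℂ) * (d.factorial : ℂ))) else 0 := by
  rw [Gpq, coeff_sum]
  split_ifs with h
  · obtain ⟨h1, h2, h3⟩ := h
    rw [Finset.sum_eq_single c]
    · rw [if_pos (by omega), show q + c - p = d by omega, show k - q - c = a by omega,
        show p - c = b by omega]
      simp
    · intro i _ hi
      split_ifs
      · rw [coeff_monomial, if_neg]
        rw [ex_inj]; tauto
      · simp
    · intro hc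
      exact absurd (Finset.mem_range.2 (by omega)) hc
  · refine Finset.sum_eq_zero fun i _ => ?_
    split_ifs with hi
    · rw [coeff_monomial, if_neg]
      rw [ex_inj]; rintro ⟨rfl, rfl, rfl, rfl⟩
      apply h; omega
    · simp

lemma homog_Gpq (k p q : ℕ) : (Gpq k p q).IsHomogeneous k := by
  refine IsHomogeneous.sum _ _ _ fun i _ => ?_
  split_ifs with h
  · apply isHomogeneous_monomial
    rw [ex_degree]; omega
  · exact isHomogeneous_zero _ _ _

lemma lapW_Gpq (k p q : ℕ) : lapW (Gpq k p q) = 0 := by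
  ext m
  rw [ex_surj m, coeff_lapW, coeff_Gpq, coeff_Gpq, coeff_zero]
  generalize m 0 = c, m 1 = d, m 2 = a, m 3 = b
  by_cases h : c + 1 + b = p ∧ d + 1 + b = q ∧ c + 1 + (d + 1) + a + b = k
  · rw [if_pos h, if_pos (by omega)]
    simp only [Nat.factorial_succ, Nat.cast_mul, pow_succ]
    have := fun n : ℕ => (Nat.cast_ne_zero (R := ℂ)).2 (Nat.factorial_ne_zero n)
    have h1 := this a
    have h2 := this b
    have h3 := this c
    have h4 := this d
    have s := fun n : ℕ => (Nat.cast_add_one_ne_zero (R := ℂ) n)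
    have := s a
    have := s b
    have := s c
    have := s d
    push_cast
    field_simp
    ring
  · rw [if_neg h, if_neg (by omega)]; ring

/-- the normalising constant -/
def cst (k p q : ℕ) : ℂ := ((k.choose p : ℂ))⁻¹ * ((k.choose q : ℂ))⁻¹ *
    ((Real.sqrt ((k + 1) / (2 * π ^ 2)) : ℝ) : ℂ)

lemma cst_ne {k p q : ℕ} (hp : p ≤ k) (hq : q ≤ k) : cst k p q ≠ 0 := by
  have h1 : (k.choose p : ℂ) ≠ 0 := Nat.cast_ne_zero.2 (Nat.choose_pos hp).ne'
  have h2 : (k.choose q : ℂ) ≠ 0 := Nat.cast_ne_zero.2 (Nat.choose_pos hq).ne'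
  have h3 : Real.sqrt ((k + 1) / (2 * π ^ 2)) ≠ 0 := by positivity
  exact mul_ne_zero (mul_ne_zero (inv_ne_zero h1) (inv_ne_zero h2)) (Complex.ofReal_ne_zero.2 h3)

lemma eval_Gpq (k : ℕ) (p q : Fin (k + 1)) (x : ℍ[ℝ]) :
    eval (wc x) (C (cst k p q) * Gpq k p q) = Fpq k p q x := by
  rw [map_mul, eval_C, Fpq, cst, Gpq, map_sum]
  congr 1
  refine Finset.sum_congr rfl fun i _ => ?_
  split_ifs with h
  · rw [eval_monomial, Finsupp.prod_fintype _ _ (by simp), Fin.prod_univ_four]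
    simp only [ex, wc, neg_pow (z1 x)]
    simp
    ring
  · simp

lemma g_shift (G : MvPolynomial (Fin 4) ℂ) (hG : lapW G = 0) (g : ℕ → ℕ → ℕ → ℕ → ℂ)
    (hg : ∀ c d a b, g c d a b = coeff (ex c d a b) G * (-1) ^ c * ((a.factorial : ℂ) *
      (b.factorial : ℂ) * (c.factorial : ℂ) * (d.factorial : ℂ))) (n : ℕ) :
    ∀ c d a b, g (c + n) (d + n) a b = g c d (a + n) (b + n) := by
  have step : ∀ c d a b, g (c + 1) (d + 1) a b = g c d (a + 1) (b + 1) := by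
    intro c d a b
    have := coeff_lapW G c d a b
    rw [hG, coeff_zero] at this
    rw [hg, hg]
    simp only [Nat.factorial_succ, Nat.cast_mul, pow_succ]
    push_cast
    linear_combination (-1) ^ c * ((a.factorial : ℂ) *
      (b.factorial : ℂ) * (c.factorial : ℂ) * (d.factorial : ℂ)) * this
  induction n with
  | zero => intros; rfl
  | succ n ih =>
    intro c d a b
    rw [← add_assoc, ← add_assoc, step, ih]
    congr 1 <;> omega

/-- Every harmonic homogeneous polynomial is a combination of the `Gpq`. -/
lemma span_Gpq {k : ℕ} (G : MvPolynomial (Fin 4) ℂ) (hG : lapW G = 0) (hk : G.IsHomogeneous k) :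
    ∃ γ : Fin (k + 1) × Fin (k + 1) → ℂ,
      G = ∑ pq, C (γ pq) * (C (cst k pq.1 pq.2) * Gpq k pq.1 pq.2) := by
  obtain ⟨g, hg⟩ : ∃ g : ℕ → ℕ → ℕ → ℕ → ℂ, ∀ c d a b, g c d a b =
      coeff (ex c d a b) G * (-1) ^ c * ((a.factorial : ℂ) *
      (b.factorial : ℂ) * (c.factorial : ℂ) * (d.factorial : ℂ)) := ⟨_, fun _ _ _ _ => rfl⟩
  have hs := g_shift G hG g hg
  have key : ∀ p q : ℕ, ∃ r : ℂ, ∀ c d a b, c + b = p → d + b = q → c + d + a + b = k →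
      g c d a b = r := by
    intro p q
    refine ⟨g (p - q) (q - p) (k - max p q) (min p q), fun c d a b h1 h2 h3 => ?_⟩
    have := hs (min c d) (p - q) (q - p) a b
    rw [show p - q + min c d = c by omega, show q - p + min c d = d by omega] at this
    rw [this]
    congr 1 <;> omega
  choose r hr using key
  have hf := fun n : ℕ => (Nat.cast_ne_zero (R := ℂ)).2 (Nat.factorial_ne_zero n)
  refine ⟨fun pq => r pq.1 pq.2 / (k.factorial * cst k pq.1 pq.2), ?_⟩
  ext m
  rw [ex_surj m]
  generalize m 0 = c, m 1 = d, m 2 = a, m 3 = b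
  simp only [coeff_sum, coeff_C_mul, coeff_Gpq]
  by_cases hdeg : c + d + a + b = k
  · rw [Finset.sum_eq_single (⟨c + b, by omega⟩, ⟨d + b, by omega⟩)]
    · have := hr _ _ c d a b rfl rfl hdeg
      have hc := cst_ne (k := k) (p := c + b) (q := d + b) (by omega) (by omega)
      simp only [hdeg, and_self, if_true]
      rw [← this, hg]
      have h1 := hf a
      have h2 := hf b
      have h3 := hf c
      have h4 := hf d
      have h5 := hf k
      have h6 : ((-1 : ℂ) ^ c) * (-1) ^ c = 1 := by rw [← mul_pow]; simp
      field_simp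
      linear_combination (- coeff (ex c d a b) G) * h6
    · rintro ⟨p, q⟩ _ hne
      rw [if_neg]
      · simp
      · rintro ⟨h1, h2, _⟩
        apply hne
        ext <;> simp [h1, h2]
    · simp
  · rw [hk.coeff_eq_zero (by rw [ex_degree]; exact hdeg)]
    symm
    refine Finset.sum_eq_zero fun pq _ => ?_
    rw [if_neg (by tauto)]; simp

lemma indep_Gpq {k : ℕ} (γ : Fin (k + 1) × Fin (k + 1) → ℂ)
    (h : ∑ pq, C (γ pq) * (C (cst k pq.1 pq.2) * Gpq k pq.1 pq.2) = 0) : ∀ pq, γ pq = 0 := by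
  rintro ⟨p, q⟩
  have hp := p.2
  have hq := q.2
  have h1 := congrArg (coeff (ex (p - q) (q - p) (k - max (p : ℕ) q) (min (p : ℕ) q))) h
  simp only [coeff_sum, coeff_C_mul, coeff_Gpq, coeff_zero] at h1
  rw [Finset.sum_eq_single (p, q)] at h1
  · rw [if_pos (by dsimp only; omega)] at h1
    have hf := fun n : ℕ => (Nat.cast_ne_zero (R := ℂ)).2 (Nat.factorial_ne_zero n)
    have hc := cst_ne (k := k) (p := p) (q := q) (by omega) (by omega)
    simpa [hc, Nat.factorial_ne_zero] using h1
  · rintro ⟨p', q'⟩ _ hne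
    rw [if_neg]
    · simp
    · rintro ⟨h1, h2, _⟩
      apply hne
      ext
      · dsimp only at *; omega
      · dsimp only at *; omega
  · simp

lemma eval_sum_Gpq {k : ℕ} (γ : Fin (k + 1) × Fin (k + 1) → ℂ) (x : ℍ[ℝ]) :
    eval (wc x) (∑ pq, C (γ pq) * (C (cst k pq.1 pq.2) * Gpq k pq.1 pq.2)) =
      (∑ pq : Fin (k + 1) × Fin (k + 1), γ pq • Fpq k pq.1 pq.2) x := by
  rw [map_sum, Finset.sum_apply]
  refine Finset.sum_congr rfl fun pq _ => ?_
  rw [map_mul, eval_Gpq, eval_C]; rfl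

lemma memWk_of {k : ℕ} (G : MvPolynomial (Fin 4) ℂ) (hG : lapW G = 0) (hk : G.IsHomogeneous k)
    (f : ℍ[ℝ] → ℂ) (hf : ∀ x, eval (wc x) G = f x) : memWk k f :=
  ⟨aeval toW G, homog_toW hk, by rw [lap_toW, hG]; simp, fun x => by rw [eval_toW, hf]⟩

lemma lapW_C_mul (r : ℂ) (G : MvPolynomial (Fin 4) ℂ) : lapW (C r * G) = C r * lapW G := by
  simp only [lapW, pderiv_C_mul, mul_add]

lemma lapW_sum {ι : Type*} (s : Finset ι) (f : ι → MvPolynomial (Fin 4) ℂ) :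
    lapW (∑ i ∈ s, f i) = ∑ i ∈ s, lapW (f i) := by
  simp only [lapW, map_sum, Finset.sum_add_distrib]

/-- A function which changes sign under an isometry preserving the sphere integrates to zero. -/
lemma integral_zero_of_neg [MeasurableSpace ℍ[ℝ]] [BorelSpace ℍ[ℝ]] (e : ℍ[ℝ] ≃ᵢ ℍ[ℝ])
    (he : ∀ x, ‖e x‖ = ‖x‖) (f : ℍ[ℝ] → ℂ) (hf : ∀ x, f (e x) = - f x) :
    ∫ x in Metric.sphere (0 : ℍ[ℝ]) 1, f x ∂(μH[3]) = 0 := by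
  have h := (e.measurePreserving_hausdorffMeasure 3).setIntegral_preimage_emb
    e.toHomeomorph.measurableEmbedding f (Metric.sphere (0 : ℍ[ℝ]) 1)
  have hs : e ⁻¹' (Metric.sphere (0 : ℍ[ℝ]) 1) = Metric.sphere (0 : ℍ[ℝ]) 1 := by
    ext x; rw [Set.mem_preimage, mem_sphere_zero_iff_norm, mem_sphere_zero_iff_norm, he]
  rw [hs] at h
  simp only [hf, integral_neg] at h
  linear_combination (-1 / 2) * h

/-- the unit quaternion `cos θ + sin θ e₁` -/
def uq (θ : ℝ) : ℍ[ℝ] := ⟨Real.cos θ, Real.sin θ, 0, 0⟩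

lemma uq_re (θ : ℝ) : (uq θ).re = Real.cos θ := rfl

lemma uq_imI (θ : ℝ) : (uq θ).imI = Real.sin θ := rfl

lemma uq_imJ (θ : ℝ) : (uq θ).imJ = 0 := rfl

lemma uq_imK (θ : ℝ) : (uq θ).imK = 0 := rfl

lemma norm_uq (θ : ℝ) : ‖uq θ‖ = 1 := by
  have h : ‖uq θ‖ * ‖uq θ‖ = 1 := by
    rw [← Quaternion.normSq_eq_norm_mul_self, Quaternion.normSq_def']
    simp [uq]
  nlinarith [norm_nonneg (uq θ)]

lemma uq_ne (θ : ℝ) : uq θ ≠ 0 := by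
  intro h; have := norm_uq θ; simp [h] at this

/-- left multiplication by a unit quaternion -/
def isoL (θ : ℝ) : ℍ[ℝ] ≃ᵢ ℍ[ℝ] :=
  ⟨Equiv.mulLeft₀ (uq θ) (uq_ne θ), Isometry.of_dist_eq fun x y => by
    simp [dist_eq_norm, ← mul_sub, norm_uq]⟩

/-- right multiplication by a unit quaternion -/
def isoR (θ : ℝ) : ℍ[ℝ] ≃ᵢ ℍ[ℝ] :=
  ⟨Equiv.mulRight₀ (uq θ) (uq_ne θ), Isometry.of_dist_eq fun x y => by
    simp [dist_eq_norm, ← sub_mul, norm_uq]⟩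

lemma isoL_apply (θ : ℝ) (x : ℍ[ℝ]) : isoL θ x = uq θ * x := rfl

lemma isoR_apply (θ : ℝ) (x : ℍ[ℝ]) : isoR θ x = x * uq θ := rfl

lemma conj_exp_I (θ : ℝ) :
    (starRingEnd ℂ) (Complex.exp (θ * Complex.I)) = Complex.exp (-(θ * Complex.I)) := by
  rw [← Complex.exp_conj]; simp

lemma z1_L (θ : ℝ) (x : ℍ[ℝ]) : z1 (uq θ * x) = Complex.exp (θ * Complex.I) * z1 x := by
  rw [Complex.exp_mul_I]
  apply Complex.ext <;> simp [z1, uq_re, uq_imI, uq_imJ, uq_imK,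
    ← Complex.ofReal_cos, ← Complex.ofReal_sin] <;> try ring

lemma z2_L (θ : ℝ) (x : ℍ[ℝ]) : z2 (uq θ * x) = Complex.exp (θ * Complex.I) * z2 x := by
  rw [Complex.exp_mul_I]
  apply Complex.ext <;> simp [z2, uq_re, uq_imI, uq_imJ, uq_imK,
    ← Complex.ofReal_cos, ← Complex.ofReal_sin] <;> try ring

lemma z1_R (θ : ℝ) (x : ℍ[ℝ]) : z1 (x * uq θ) = Complex.exp (θ * Complex.I) * z1 x := by
  rw [Complex.exp_mul_I]
  apply Complex.ext <;> simp [z1, uq_re, uq_imI, uq_imJ, uq_imK,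
    ← Complex.ofReal_cos, ← Complex.ofReal_sin] <;> try ring

lemma z2_R (θ : ℝ) (x : ℍ[ℝ]) : z2 (x * uq θ) = Complex.exp (-(θ * Complex.I)) * z2 x := by
  rw [← neg_mul, ← Complex.ofReal_neg, Complex.exp_mul_I]
  apply Complex.ext <;> simp [z2, uq_re, uq_imI, uq_imJ, uq_imK,
    ← Complex.ofReal_cos, ← Complex.ofReal_sin] <;> try ring

lemma Fpq_L (k : ℕ) (p q : Fin (k + 1)) (θ : ℝ) (x : ℍ[ℝ]) :
    Fpq k p q (uq θ * x) = Complex.exp (θ * Complex.I) ^ (k - q : ℕ) *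
      Complex.exp (-(θ * Complex.I)) ^ (q : ℕ) * Fpq k p q x := by
  simp only [Fpq, z1_L, z2_L, map_mul, conj_exp_I]
  generalize Complex.exp (θ * Complex.I) = u
  generalize Complex.exp (-(θ * Complex.I)) = v
  rw [mul_left_comm]
  congr 1
  rw [Finset.mul_sum]
  refine Finset.sum_congr rfl fun i _ => ?_
  split_ifs with h
  · have e1 : u ^ (k - q : ℕ) = u ^ (k - q - i : ℕ) * u ^ i := by
      rw [← pow_add]; congr 1; omega
    have e2 : v ^ (q : ℕ) = v ^ ((p : ℕ) - i : ℕ) * v ^ ((q : ℕ) + i - p) := by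
      rw [← pow_add]; congr 1; omega
    rw [e1, e2, ← mul_neg]
    simp only [mul_pow]
    ring
  · simp

lemma Fpq_R (k : ℕ) (p q : Fin (k + 1)) (θ : ℝ) (x : ℍ[ℝ]) :
    Fpq k p q (x * uq θ) = Complex.exp (-(θ * Complex.I)) ^ (k - p : ℕ) *
      Complex.exp (θ * Complex.I) ^ (p : ℕ) * Fpq k p q x := by
  have hc : (starRingEnd ℂ) (Complex.exp (-(θ * Complex.I))) = Complex.exp (θ * Complex.I) := by
    rw [← conj_exp_I]; simp
  simp only [Fpq, z1_R, z2_R, map_mul, conj_exp_I, hc]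
  generalize Complex.exp (θ * Complex.I) = u
  generalize Complex.exp (-(θ * Complex.I)) = v
  rw [mul_left_comm]
  congr 1
  rw [Finset.mul_sum]
  refine Finset.sum_congr rfl fun i _ => ?_
  split_ifs with h
  · have e1 : v ^ (k - p : ℕ) = v ^ (k - q - i : ℕ) * v ^ ((q : ℕ) + i - p) := by
      rw [← pow_add]; congr 1; omega
    have e2 : u ^ (p : ℕ) = u ^ ((p : ℕ) - i : ℕ) * u ^ i := by
      rw [← pow_add]; congr 1; omega
    rw [e1, e2, ← mul_neg]
    simp only [mul_pow]
    ring
  · simp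

lemma phase {k q q' : ℕ} (hq : q ≤ k) (hq' : q' ≤ k) (hne : q ≠ q') (z : ℂ)
    (hz : z = ((π / (2 * ((q : ℝ) - q')) : ℝ) : ℂ) * Complex.I) :
    (Complex.exp (-z) ^ (k - q) * Complex.exp z ^ q) *
      (Complex.exp z ^ (k - q') * Complex.exp (-z) ^ q') = -1 := by
  simp only [← Complex.exp_nat_mul, ← Complex.exp_add]
  rw [← Complex.exp_pi_mul_I]
  congr 1
  have h : (q : ℂ) - q' ≠ 0 := sub_ne_zero.2 (by exact_mod_cast hne)
  push_cast [Nat.cast_sub hq, Nat.cast_sub hq', hz]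
  field_simp
  ring

lemma phase' {k q q' : ℕ} (hq : q ≤ k) (hq' : q' ≤ k) (hne : q ≠ q') (z : ℂ)
    (hz : z = ((π / (2 * ((q : ℝ) - q')) : ℝ) : ℂ) * Complex.I) :
    (Complex.exp z ^ (k - q) * Complex.exp (-z) ^ q) *
      (Complex.exp (-z) ^ (k - q') * Complex.exp z ^ q') = -1 := by
  have h := congrArg (fun w => w⁻¹) (phase hq hq' hne z hz)
  simp only [mul_inv, ← inv_pow, ← Complex.exp_neg, neg_neg] at h
  rw [h]; norm_num

/-- The `(k+1)²` functions `F_{p,q}` are harmonic homogeneous polynomials of degree `k`,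
form a `ℂ`-basis of `W_k`, and are pairwise orthogonal in `L²(S³, ν)`. -/
theorem Fpq_basis_of_Wk [MeasurableSpace ℍ[ℝ]] [BorelSpace ℍ[ℝ]] (k : ℕ) :
    (∀ p q : Fin (k + 1), memWk k (Fpq k p q)) ∧
    LinearIndependent ℂ (fun pq : Fin (k + 1) × Fin (k + 1) => Fpq k pq.1 pq.2) ∧
    (Submodule.span ℂ
        (Set.range (fun pq : Fin (k + 1) × Fin (k + 1) => Fpq k pq.1 pq.2)) :
      Set (ℍ[ℝ] → ℂ)) = {f | memWk k f} ∧
    ∀ p q p' q' : Fin (k + 1), (p, q) ≠ (p', q') →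
      ∫ x in Metric.sphere (0 : ℍ[ℝ]) 1,
          (starRingEnd ℂ) (Fpq k p q x) * Fpq k p' q' x ∂(μH[3]) = 0 := by
  refine ⟨fun p q => ?_, ?_, ?_, ?_⟩
  · refine memWk_of (C (cst k p q) * Gpq k p q) ?_ ((homog_Gpq k p q).C_mul _) _ (eval_Gpq k p q)
    rw [lapW_C_mul, lapW_Gpq, mul_zero]
  · rw [Fintype.linearIndependent_iff]
    intro γ hγ
    apply indep_Gpq γ
    rw [← toX_toW (∑ pq, C (γ pq) * (C (cst k pq.1 pq.2) * Gpq k pq.1 pq.2)),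
      eq_zero_of_eval_coords (aeval toW _), map_zero]
    intro x
    rw [eval_toW, eval_sum_Gpq, hγ]; rfl
  · ext f
    constructor
    · intro hf
      obtain ⟨γ, rfl⟩ := (Submodule.mem_span_range_iff_exists_fun ℂ).1 hf
      refine memWk_of _ ?_ ?_ _ (eval_sum_Gpq γ)
      · rw [lapW_sum]
        refine Finset.sum_eq_zero fun pq _ => ?_
        rw [lapW_C_mul, lapW_C_mul, lapW_Gpq, mul_zero, mul_zero]
      · exact IsHomogeneous.sum _ _ _ fun pq _ => ((homog_Gpq k _ _).C_mul _).C_mul _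
    · rintro ⟨P, hP, hL, hf⟩
      have h4 : lapW (aeval toX P) = 0 := by
        have := lap_toX P
        rw [hL, map_zero] at this
        simpa using this
      obtain ⟨γ, hγ⟩ := span_Gpq _ h4 (homog_toX hP)
      refine (Submodule.mem_span_range_iff_exists_fun ℂ).2 ⟨γ, ?_⟩
      funext x
      rw [← eval_sum_Gpq, ← hγ, eval_toX, hf]
  · intro p q p' q' hne
    have hp := Nat.lt_succ_iff.1 p.2
    have hp' := Nat.lt_succ_iff.1 p'.2
    have hq := Nat.lt_succ_iff.1 q.2
    have hq' := Nat.lt_succ_iff.1 q'.2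
    by_cases h : (q : ℕ) = q'
    · have h' : (p : ℕ) ≠ p' := fun h2 => hne (Prod.ext (Fin.ext h2) (Fin.ext h))
      refine integral_zero_of_neg (isoR (π / (2 * ((p : ℕ) - (p' : ℕ) : ℝ))))
        (fun x => by simp [isoR_apply, norm_uq]) _ fun x => ?_
      have := phase' hp hp' h' _ rfl
      rw [isoR_apply, Fpq_R, Fpq_R]
      simp only [map_mul, map_pow, ← conj_exp_I, Complex.conj_conj] at this ⊢
      linear_combination ((starRingEnd ℂ) (Fpq k p q x) * Fpq k p' q' x) * this
    · refine integral_zero_of_neg (isoL (π / (2 * ((q : ℕ) - (q' : ℕ) : ℝ))))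
        (fun x => by simp [isoL_apply, norm_uq]) _ fun x => ?_
      have := phase hq hq' h _ rfl
      rw [isoL_apply, Fpq_L, Fpq_L]
      simp only [map_mul, map_pow, ← conj_exp_I, Complex.conj_conj] at this ⊢
      linear_combination ((starRingEnd ℂ) (Fpq k p q x) * Fpq k p' q' x) * this

end
end

section
/- If k is a natural number, σ ∈ V_k is nonzero, c is a real number, and D̄σ = c·σ, then c = −k or c = k + 2. -/
open Quaternion MvPolynomial

noncomputable section

def coordsL : ℍ[ℝ] →L[ℝ] (Fin 4 → ℝ) := LinearMap.toContinuousLinearMap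
  { toFun := coords
    map_add' := fun x y => by ext i; fin_cases i <;> simp [coords]
    map_smul' := fun r x => by ext i; fin_cases i <;> simp [coords] }

lemma coordsL_apply (x : ℍ[ℝ]) : coordsL x = coords x := rfl

lemma hasF (P : MvPolynomial (Fin 4) ℝ) (x : ℍ[ℝ]) :
    HasFDerivAt (fun x => eval (coords x) P)
      (∑ i, eval (coords x) (pderiv i P) • ((ContinuousLinearMap.proj (R := ℝ) (φ := fun _ : Fin 4 => ℝ) i).comp coordsL)) x := by
  induction P using MvPolynomial.induction_on with
  | C a => simpa using hasFDerivAt_const a x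
  | add p q hp hq =>
    simp only [map_add, add_smul, Finset.sum_add_distrib]
    exact hp.add hq
  | mul_X p j hp =>
    have h2 : HasFDerivAt (fun x : ℍ[ℝ] => coords x j) ((ContinuousLinearMap.proj (R := ℝ) (φ := fun _ : Fin 4 => ℝ) j).comp coordsL) x :=
      ((ContinuousLinearMap.proj (R := ℝ) (φ := fun _ : Fin 4 => ℝ) j).comp coordsL).hasFDerivAt
    have := hp.mul h2
    simp only [map_mul, eval_X]
    refine HasFDerivAt.congr_fderiv this ?_
    apply ContinuousLinearMap.ext
    intro v
    fin_cases j <;> simp [Fin.sum_univ_four, Derivation.leibniz, pderiv_X, Pi.single_apply] <;> ring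

def l1 : MvPolynomial (Fin 4) ℝ →ₗ[ℝ] MvPolynomial (Fin 4) ℝ :=
  ((-X 1 : MvPolynomial (Fin 4) ℝ) • pderiv 0 + (X 0 : MvPolynomial (Fin 4) ℝ) • pderiv 1
    + (X 3 : MvPolynomial (Fin 4) ℝ) • pderiv 2 + (-X 2 : MvPolynomial (Fin 4) ℝ) • pderiv 3 :
    Derivation ℝ (MvPolynomial (Fin 4) ℝ) (MvPolynomial (Fin 4) ℝ))
def l2 : MvPolynomial (Fin 4) ℝ →ₗ[ℝ] MvPolynomial (Fin 4) ℝ :=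
  ((-X 2 : MvPolynomial (Fin 4) ℝ) • pderiv 0 + (-X 3 : MvPolynomial (Fin 4) ℝ) • pderiv 1
    + (X 0 : MvPolynomial (Fin 4) ℝ) • pderiv 2 + (X 1 : MvPolynomial (Fin 4) ℝ) • pderiv 3 :
    Derivation ℝ (MvPolynomial (Fin 4) ℝ) (MvPolynomial (Fin 4) ℝ))
def l3 : MvPolynomial (Fin 4) ℝ →ₗ[ℝ] MvPolynomial (Fin 4) ℝ :=
  ((-X 3 : MvPolynomial (Fin 4) ℝ) • pderiv 0 + (X 2 : MvPolynomial (Fin 4) ℝ) • pderiv 1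
    + (-X 1 : MvPolynomial (Fin 4) ℝ) • pderiv 2 + (X 0 : MvPolynomial (Fin 4) ℝ) • pderiv 3 :
    Derivation ℝ (MvPolynomial (Fin 4) ℝ) (MvPolynomial (Fin 4) ℝ))

lemma l1_apply (P) : l1 P = -X 1 * pderiv 0 P + X 0 * pderiv 1 P + X 3 * pderiv 2 P + -X 2 * pderiv 3 P := by
  simp [l1]
lemma l2_apply (P) : l2 P = -X 2 * pderiv 0 P + -X 3 * pderiv 1 P + X 0 * pderiv 2 P + X 1 * pderiv 3 P := by
  simp [l2]
lemma l3_apply (P) : l3 P = -X 3 * pderiv 0 P + X 2 * pderiv 1 P + -X 1 * pderiv 2 P + X 0 * pderiv 3 P := by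
  simp [l3]

lemma pc (i j : Fin 4) (P : MvPolynomial (Fin 4) ℝ) :
    pderiv i (pderiv j P) = pderiv j (pderiv i P) := by
  have key : ∀ D1 D2 : Derivation ℝ (MvPolynomial (Fin 4) ℝ) (MvPolynomial (Fin 4) ℝ),
      (∀ m, D1 (D2 (X m)) = D2 (D1 (X m))) → D1 (D2 P) = D2 (D1 P) := by
    intro D1 D2 h
    have : ⁅D1, D2⁆ = 0 := by
      apply MvPolynomial.derivation_ext
      intro m
      simp [Derivation.commutator_apply, h]
    have h := congrArg (fun D => D P) this
    simpa [Derivation.commutator_apply, sub_eq_zero] using h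
  apply key
  intro m
  simp only [pderiv_X, Pi.single_apply]
  split_ifs <;> simp

lemma comm12 (P) : l1 (l2 P) - l2 (l1 P) = 2 * l3 P := by
  simp only [l1_apply, l2_apply, l3_apply, map_add, Derivation.leibniz, map_neg, pderiv_X, Pi.single_apply, smul_eq_mul]
  rw [pc 1 0, pc 2 0, pc 3 0, pc 2 1, pc 3 1, pc 3 2]
  simp
  ring
lemma comm23 (P) : l2 (l3 P) - l3 (l2 P) = 2 * l1 P := by
  simp only [l1_apply, l2_apply, l3_apply, map_add, Derivation.leibniz, map_neg, pderiv_X, Pi.single_apply, smul_eq_mul]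
  rw [pc 1 0, pc 2 0, pc 3 0, pc 2 1, pc 3 1, pc 3 2]
  simp
  ring
lemma comm31 (P) : l3 (l1 P) - l1 (l3 P) = 2 * l2 P := by
  simp only [l1_apply, l2_apply, l3_apply, map_add, Derivation.leibniz, map_neg, pderiv_X, Pi.single_apply, smul_eq_mul]
  rw [pc 1 0, pc 2 0, pc 3 0, pc 2 1, pc 3 1, pc 3 2]
  simp
  ring

lemma euler (k : ℕ) (P : MvPolynomial (Fin 4) ℝ) (h : P.IsHomogeneous k) :
    X 0 * pderiv 0 P + X 1 * pderiv 1 P + X 2 * pderiv 2 P + X 3 * pderiv 3 P = (k : MvPolynomial (Fin 4) ℝ) * P := by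
  have := h.sum_X_mul_pderiv
  simpa [Fin.sum_univ_four] using this

lemma casimir (k : ℕ) (P : MvPolynomial (Fin 4) ℝ) (h : P.IsHomogeneous k)
    (hh : (∑ i : Fin 4, pderiv i (pderiv i P)) = 0) :
    l1 (l1 P) + l2 (l2 P) + l3 (l3 P) = -((k : MvPolynomial (Fin 4) ℝ) * (k + 2) * P) := by
  have e := euler k P h
  have e0 := congrArg (pderiv 0) e
  have e1 := congrArg (pderiv 1) e
  have e2 := congrArg (pderiv 2) e
  have e3 := congrArg (pderiv 3) e
  rw [Fin.sum_univ_four] at hh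
  simp only [map_add, Derivation.leibniz, pderiv_X, Pi.single_apply, smul_eq_mul, Derivation.map_natCast] at e0 e1 e2 e3
  simp only [l1_apply, l2_apply, l3_apply, map_add, Derivation.leibniz, map_neg, pderiv_X, Pi.single_apply, smul_eq_mul]
  rw [pc 1 0, pc 2 0, pc 3 0, pc 2 1, pc 3 1, pc 3 2]
  rw [pc 1 0] at e1
  rw [pc 2 0, pc 2 1] at e2
  rw [pc 3 0, pc 3 1, pc 3 2] at e3
  simp at e0 e1 e2 e3 ⊢
  linear_combination (X 0 ^ 2 + X 1 ^ 2 + X 2 ^ 2 + X 3 ^ 2) * hh - X 0 * e0 - X 1 * e1 - X 2 * e2 - X 3 * e3 - (k+2) * e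

@[simp] lemma e1_re : e1.re = 0 := rfl
@[simp] lemma e1_imI : e1.imI = 1 := rfl
@[simp] lemma e1_imJ : e1.imJ = 0 := rfl
@[simp] lemma e1_imK : e1.imK = 0 := rfl
@[simp] lemma e2_re : e2.re = 0 := rfl
@[simp] lemma e2_imI : e2.imI = 0 := rfl
@[simp] lemma e2_imJ : e2.imJ = 1 := rfl
@[simp] lemma e2_imK : e2.imK = 0 := rfl
@[simp] lemma e3_re : e3.re = 0 := rfl
@[simp] lemma e3_imI : e3.imI = 0 := rfl
@[simp] lemma e3_imJ : e3.imJ = 0 := rfl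
@[simp] lemma e3_imK : e3.imK = 1 := rfl
lemma coords_fderiv (σ : ℍ[ℝ] → ℍ[ℝ]) (P : Fin 4 → MvPolynomial (Fin 4) ℝ)
    (hP : ∀ c x, eval (coords x) (P c) = coords (σ x) c) (x v : ℍ[ℝ]) (j : Fin 4) :
    coords (fderiv ℝ σ x v) j = ∑ i, eval (coords x) (pderiv i (P j)) * coords v i := by
  have hd : DifferentiableAt ℝ σ x := by
    have h : σ = fun x => eval (coords x) (P 0) • (1 : ℍ[ℝ]) + eval (coords x) (P 1) • e1
        + eval (coords x) (P 2) • e2 + eval (coords x) (P 3) • e3 := by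
      funext y
      simp only [hP]
      ext <;> simp [coords]
    rw [h]
    have d := fun j => (hasF (P j) x).differentiableAt
    exact ((((d 0).smul_const _).add ((d 1).smul_const _)).add ((d 2).smul_const _)).add
      ((d 3).smul_const _)
  have h1 := ((ContinuousLinearMap.proj (R := ℝ) (φ := fun _ : Fin 4 => ℝ) j).comp
    coordsL).hasFDerivAt.comp x hd.hasFDerivAt
  have h2 := hasF (P j) x
  have h3 : (fun x => eval (coords x) (P j)) =
      (((ContinuousLinearMap.proj (R := ℝ) (φ := fun _ : Fin 4 => ℝ) j).comp coordsL) ∘ σ) := by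
    funext y
    simp [hP, coordsL_apply]
  rw [h3] at h2
  have h4 := congrArg (fun L => L v) (h1.unique h2)
  simpa [coordsL_apply] using h4

lemma coords_surj_s7 (y : Fin 4 → ℝ) : coords ⟨y 0, y 1, y 2, y 3⟩ = y := by
  ext i; fin_cases i <;> simp [coords]

theorem eigenvalues_of_Dbar (k : ℕ) (σ : ℍ[ℝ] → ℍ[ℝ]) (hσ : memVk k σ) (hσ0 : σ ≠ 0)
    (c : ℝ) (hc : Dbar σ = c • σ) :
    c = -(k : ℝ) ∨ c = (k : ℝ) + 2 := by
  choose P hom harm hP using hσ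
  have hf := coords_fderiv σ P hP
  have hcomp : ∀ y x j, coords x = y → coords (Dbar σ x) j = c * eval y (P j) := by
    intro y x j hx
    rw [hc, ← hx, hP]
    fin_cases j <;> simp [coords]
  have hL : ∀ y x j, coords x = y → coords (Lop e1 σ x) j = eval y (l1 (P j)) ∧
      coords (Lop e2 σ x) j = eval y (l2 (P j)) ∧ coords (Lop e3 σ x) j = eval y (l3 (P j)) := by
    intro y x j hx
    subst hx
    simp only [Lop, hf, l1_apply, l2_apply, l3_apply, Fin.sum_univ_four]
    refine ⟨?_, ?_, ?_⟩ <;> simp [coords] <;> ring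
  have key : C c * P 0 = l1 (P 1) + l2 (P 2) + l3 (P 3) ∧
      C c * P 1 = -(l1 (P 0) - l2 (P 3) + l3 (P 2)) ∧
      C c * P 2 = -(l1 (P 3) + l2 (P 0) - l3 (P 1)) ∧
      C c * P 3 = -(-l1 (P 2) + l2 (P 1) + l3 (P 0)) := by
    refine ⟨?_, ?_, ?_, ?_⟩ <;> apply MvPolynomial.funext <;> intro y <;>
      have hx := coords_surj_s7 y <;> set x : ℍ[ℝ] := ⟨y 0, y 1, y 2, y 3⟩ with hxd <;>
      clear_value x <;> simp only [map_add, map_neg, map_sub, map_mul, eval_C] <;>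
      simp only [← (hL y x _ hx).1, ← (hL y x _ hx).2.1, ← (hL y x _ hx).2.2,
        ← hcomp y x _ hx] <;>
      simp [coords, Dbar] <;> ring
  obtain ⟨k0, k1, k2, k3⟩ := key
  have lc1 : ∀ Q, l1 (C c * Q) = C c * l1 Q := fun Q => by simp only [← smul_eq_C_mul, map_smul]
  have lc2 : ∀ Q, l2 (C c * Q) = C c * l2 Q := fun Q => by simp only [← smul_eq_C_mul, map_smul]
  have lc3 : ∀ Q, l3 (C c * Q) = C c * l3 Q := fun Q => by simp only [← smul_eq_C_mul, map_smul]
  have hcas := fun j => casimir k (P j) (hom j) (harm j)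
  have m1 := fun {a b : MvPolynomial (Fin 4) ℝ} (h : a = b) => congrArg l1 h
  have m2 := fun {a b : MvPolynomial (Fin 4) ℝ} (h : a = b) => congrArg l2 h
  have m3 := fun {a b : MvPolynomial (Fin 4) ℝ} (h : a = b) => congrArg l3 h
  have a0 := m1 k0
  have a1 := m1 k1
  have a2 := m1 k2
  have a3 := m1 k3
  have b0 := m2 k0
  have b1 := m2 k1
  have b2 := m2 k2
  have b3 := m2 k3
  have c0 := m3 k0
  have c1 := m3 k1
  have c2 := m3 k2
  have c3 := m3 k3
  simp only [lc1, lc2, lc3, map_add, map_neg, map_sub] at a0 a1 a2 a3 b0 b1 b2 b3 c0 c1 c2 c3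
  have q : ∀ j, ((C c * C c - 2 * C c - (k : MvPolynomial (Fin 4) ℝ) * ((k : MvPolynomial (Fin 4) ℝ) + 2)) * P j : MvPolynomial (Fin 4) ℝ) = 0 := by
    intro j
    fin_cases j
    · show _ * P 0 = 0
      linear_combination (C c - 2) * k0 + a1 + b2 + c3 - hcas 0 + comm12 (P 3) + comm23 (P 1) + comm31 (P 2)
    · show _ * P 1 = 0
      linear_combination (C c - 2) * k1 - a0 + b3 - c2 - hcas 1 - comm12 (P 2) - comm23 (P 0) + comm31 (P 3)
    · show _ * P 2 = 0
      linear_combination (C c - 2) * k2 - a3 - b0 + c1 - hcas 2 + comm12 (P 1) - comm23 (P 3) - comm31 (P 0)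
    · show _ * P 3 = 0
      linear_combination (C c - 2) * k3 + a2 - b1 - c0 - hcas 3 - comm12 (P 0) + comm23 (P 2) - comm31 (P 1)
  obtain ⟨x, hx⟩ := Function.ne_iff.mp hσ0
  have hj : ∃ j, eval (coords x) (P j) ≠ 0 := by
    by_contra! h
    simp only [hP] at h
    apply hx
    have h0 := h 0
    have h1 := h 1
    have h2 := h 2
    have h3 := h 3
    simp [coords] at h0 h1 h2 h3
    ext <;> simp [*]
  obtain ⟨j, hj⟩ := hj
  have h := congrArg (eval (coords x)) (q j)
  simp only [map_mul, map_sub, map_add, eval_C, map_natCast, map_ofNat, map_zero] at h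
  have h2 : (c + k) * (c - (k + 2)) = 0 := by
    rcases mul_eq_zero.mp h with h | h
    · linear_combination h
    · exact absurd h hj
  rcases mul_eq_zero.mp h2 with h | h
  · left; linarith
  · right; linarith

end
end
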